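/- Let J be an invariant-factor count function for d = 12, and let M be the symmetric 4×4 real matrix with rows (1, 5/8, 1/2, 1/8), (5/8, 1, −1/8, 1/4), (1/2, −1/8, 1, 3/8), (1/8, 1/4, 3/8, 1/2). Then for every 4×4 real matrix A satisfying A·Aᵀ = M and every x ∈ ℝ, lim_{n→∞} (1/n)·#{1 ≤ m ≤ n : J(m) ≤ (1/4)·log log n + x·((1/2)·log log n)^{1/2}} = γ⁴({z ∈ ℝ⁴ : min_{1≤i≤4} (A·z)_i ≤ x}). In particular this limit exists and is independent of the choice of A. -/

import Mathlib

open MeasureTheory ProbabilityTheory Filter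

noncomputable section

/-- A key encoding the lexicographic order on pairs `(φ(q), q)`; this is a valid
encoding on prime powers since every prime power satisfies `q ≤ 2 * φ(q)`. -/
def ppKey (q : ℕ) : ℕ := 2 * Nat.totient q ^ 2 + q

/-- The `n`-th smallest key of a prime power (0-indexed). -/
def ppNthKey (n : ℕ) : ℕ := Nat.nth (fun k => ∃ q : ℕ, IsPrimePow q ∧ ppKey q = k) n

/-- The total φ-sequence `q̃_i` (1-indexed): the enumeration of all prime powers
ordered by nondecreasing totient, with ties broken by increasing size. -/
def qt (i : ℕ) : ℕ := sInf {q : ℕ | IsPrimePow q ∧ ppKey q = ppNthKey (i - 1)}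

/-- `lcm(q̃_1, …, q̃_i)`. -/
def Lseq (i : ℕ) : ℕ := (Finset.Icc 1 i).lcm qt

/-- The universal factor order set `f_i`. -/
def UFO (i : ℕ) : Set ℕ :=
  if Nat.totient (qt i) < Nat.totient (qt (i + 1)) then {Lseq i}
  else {Lseq i, Nat.lcm (Lseq (i - 1)) (qt (i + 1))}

/-- `φ(q̃_i)` as a real number. -/
def phiQ (i : ℕ) : ℝ := (Nat.totient (qt i) : ℝ)

/-- `μ_i = 1/φ(q̃_i) − 1/φ(q̃_{i+1})`. -/
def muSeq (i : ℕ) : ℝ := 1 / phiQ i - 1 / phiQ (i + 1)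

/-- `σ_i = (1/φ(q̃_i) + 1/φ(q̃_{i+1}) − 2/(φ(q̃_i)·φ(q̃_{i+1})))^{1/2}`. -/
def sigSeq (i : ℕ) : ℝ :=
  Real.sqrt (1 / phiQ i + 1 / phiQ (i + 1) - 2 / (phiQ i * phiQ (i + 1)))

/-- `σ_{i;a,b} = (φ(q̃_i)^{−a} + φ(q̃_{i+1})^{−b} − 2/(φ(q̃_i)·φ(q̃_{i+1})))^{1/2}`. -/
def sigAB (i a b : ℕ) : ℝ :=
  Real.sqrt (1 / phiQ i ^ a + 1 / phiQ (i + 1) ^ b - 2 / (phiQ i * phiQ (i + 1)))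

/-- `ν_j = (φ(q̃_j)^{−1}·(1 − φ(q̃_j)^{−1}))^{1/2}`. -/
def nuSeq (j : ℕ) : ℝ := Real.sqrt (1 / phiQ j * (1 - 1 / phiQ j))

/-- `J` is an invariant-factor count function for `d`: whenever `(ℤ/mℤ)ˣ` is isomorphic to
a direct product of cyclic groups `ℤ/λ_1 × ⋯ × ℤ/λ_K` with `1 < λ_1 ∣ λ_2 ∣ ⋯ ∣ λ_K`,
`J m` is the number of indices `j` with `λ_j = d`. -/
def IsInvCount (d : ℕ) (J : ℕ → ℕ) : Prop :=
  ∀ m : ℕ, 1 ≤ m → ∀ K : ℕ, ∀ lam : Fin K → ℕ,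
    (∀ j, 1 < lam j) →
    (∀ j k : Fin K, j ≤ k → lam j ∣ lam k) →
    Nonempty ((ZMod m)ˣ ≃* Multiplicative (∀ j : Fin K, ZMod (lam j))) →
    J m = (Finset.univ.filter fun j : Fin K => lam j = d).card

/-- The number of `m ∈ {1, …, n}` satisfying `P`. -/
def cnt (P : ℕ → Prop) (n : ℕ) : ℕ := {m : ℕ | 1 ≤ m ∧ m ≤ n ∧ P m}.ncard

/-- The average `(1/n)·∑_{m=1}^n J(m)`. -/
def avg (J : ℕ → ℕ) (n : ℕ) : ℝ := (∑ m ∈ Finset.Icc 1 n, (J m : ℝ)) / n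

/-- `log log n`. -/
def LL (n : ℕ) : ℝ := Real.log (Real.log n)

/-- The standard normal cumulative distribution function. -/
def Phi (x : ℝ) : ℝ := (Real.sqrt (2 * Real.pi))⁻¹ * ∫ t in Set.Iic x, Real.exp (-t ^ 2 / 2)

/-- Owen's T-function. -/
def OwenT (h a : ℝ) : ℝ :=
  (2 * Real.pi)⁻¹ * ∫ t in (0:ℝ)..a, Real.exp (-(1 + t ^ 2) * h ^ 2 / 2) / (1 + t ^ 2)

/-- The skew-normal cumulative distribution function with parameter `α`. -/
def PhiSkew (x α : ℝ) : ℝ := Phi x - 2 * OwenT x α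

/-- The standard Gaussian probability measure `γ^k` on `ℝ^k`. -/
def stdGaussian (k : ℕ) : Measure (Fin k → ℝ) :=
  Measure.pi fun _ => gaussianReal 0 1

/-- `ω(m;q,1)`: the number of distinct primes `p ∣ m` with `p ≡ 1 (mod q)`. -/
def omegaQ (m q : ℕ) : ℕ := (m.primeFactors.filter fun p => p % q = 1 % q).card

/-- The correction term `Ē(m;p^α)`. -/
def Ebar (m p α : ℕ) : ℕ :=
  if p ^ α = 2 ∧ 8 ∣ m then 2
  else if p ^ α = 2 ∧ 4 ∣ m ∧ ¬(8 ∣ m) then 1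
  else if p = 2 ∧ 2 ≤ α ∧ 2 ^ (α + 2) ∣ m then 1
  else if p ≠ 2 ∧ p ^ (α + 1) ∣ m then 1
  else 0

/-- `prm(m;q)` for a prime power `q = p^α`: the unique `k` such that `p^k` is the cardinality
of the subgroup `{x ∈ (ℤ/mℤ)ˣ : x^p = 1 and x = y^{p^{α−1}} for some y}` (obtained here as the
`p`-adic valuation of that cardinality; note `p = q.minFac` and `p^{α−1} = q / p`). -/
def prm (m q : ℕ) : ℕ :=
  (Nat.card {x : (ZMod m)ˣ // x ^ q.minFac = 1 ∧ ∃ y : (ZMod m)ˣ, y ^ (q / q.minFac) = x}).factorization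
    q.minFac

/-- `m` is `y`-typical: for all prime powers `q₁, q₂` with `φ(q₁) ≤ y` and `φ(q₁) < φ(q₂)`
one has `prm(m;q₁) > prm(m;q₂)`. -/
def yTypical (y : ℝ) (m : ℕ) : Prop :=
  ∀ q₁ q₂ : ℕ, IsPrimePow q₁ → IsPrimePow q₂ →
    (Nat.totient q₁ : ℝ) ≤ y → Nat.totient q₁ < Nat.totient q₂ →
    prm m q₂ < prm m q₁

open ArithmeticFunction ArithmeticFunction.vonMangoldt in
/-- The Dirichlet series of the von Mangoldt function on an invertible residue class has a simple
pole with residue `1 / φ(k)` at `1`, with a remainder bounded on `(1, 2]`. -/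
theorem abs_tsum_residueClass_sub_le {k : ℕ} [NeZero k] {a : ZMod k} (ha : IsUnit a) :
    ∃ C : ℝ, ∀ x ∈ Set.Ioc (1 : ℝ) 2,
      |∑' n, residueClass a n / (n : ℝ) ^ x - (k.totient : ℝ)⁻¹ / (x - 1)| ≤ C := by
  have H {x : ℝ} (hx : 1 < x) :
      ∑' n, residueClass a n / (n : ℝ) ^ x =
        (LFunctionResidueClassAux a x).re + (k.totient : ℝ)⁻¹ / (x - 1) := by
    refine Complex.ofReal_injective ?_
    simp only [Complex.ofReal_tsum, Complex.ofReal_div, Complex.ofReal_cpow (Nat.cast_nonneg _),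
      Complex.ofReal_natCast, Complex.ofReal_add, Complex.ofReal_inv, Complex.ofReal_sub,
      Complex.ofReal_one]
    simp_rw [← LFunctionResidueClassAux_real ha hx,
      eqOn_LFunctionResidueClassAux ha <| Set.mem_ofPred.mpr (Complex.ofReal_re x ▸ hx),
      sub_add_cancel, LSeries, LSeries.term]
    refine tsum_congr fun n ↦ ?_
    split_ifs with hn
    · simp only [hn, residueClass_apply_zero, Complex.ofReal_zero, zero_div]
    · rfl
  have hc : ContinuousOn (fun x : ℝ ↦ (LFunctionResidueClassAux a x).re) (Set.Icc 1 2) :=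
    Complex.continuous_re.continuousOn.comp (t := Set.univ)
      (continuousOn_LFunctionResidueClassAux a)
      (fun x _ ↦ trivial) |>.comp Complex.continuous_ofReal.continuousOn fun x hx ↦ by
        simpa only [Set.mem_ofPred_eq, Complex.ofReal_re] using hx.1
  obtain ⟨C, hC⟩ := isCompact_Icc.exists_bound_of_continuousOn hc
  refine ⟨C, fun x hx ↦ ?_⟩
  rw [H hx.1, add_sub_cancel_right]
  exact hC x (Set.Ioc_subset_Icc_self hx)

open ArithmeticFunction ArithmeticFunction.vonMangoldt in
theorem summable_residueClass_div_rpow {k : ℕ} (a : ZMod k) {x : ℝ} (hx : 1 < x) :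
    Summable fun n : ℕ ↦ residueClass a n / (n : ℝ) ^ x := by
  have h : LSeriesSummable (fun n : ℕ ↦ ((residueClass a n : ℝ) : ℂ)) (x : ℂ) := by
    apply LSeriesSummable_of_abscissaOfAbsConv_lt_re
    refine lt_of_le_of_lt (abscissaOfAbsConv_residueClass_le_one a) ?_
    simpa using mod_cast hx
  refine (h.norm).congr fun n ↦ ?_
  rcases eq_or_ne n 0 with rfl | hn
  · simp
  · rw [LSeries.term_of_ne_zero hn, norm_div, Complex.norm_real,
      Complex.norm_natCast_cpow_of_pos (Nat.pos_of_ne_zero hn), Real.norm_of_nonneg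
      (residueClass_nonneg a n), Complex.ofReal_re]


theorem ofReal_tsum_eq_LSeries {f : ℕ → ℝ} (hf : f 0 = 0) (x : ℝ) :
    ((∑' n, f n / (n : ℝ) ^ x : ℝ) : ℂ) = LSeries (fun n ↦ (f n : ℂ)) (x : ℂ) := by
  rw [Complex.ofReal_tsum, LSeries]
  refine tsum_congr fun n ↦ ?_
  rcases eq_or_ne n 0 with rfl | hn
  · simp [hf]
  · rw [LSeries.term_of_ne_zero hn, Complex.ofReal_div, Complex.ofReal_cpow (Nat.cast_nonneg _),
      Complex.ofReal_natCast]

open ArithmeticFunction ArithmeticFunction.vonMangoldt in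
theorem hasDerivAt_tsum_residueClass_div_log {k : ℕ} (a : ZMod k) {x : ℝ} (hx : 1 < x) :
    HasDerivAt (fun x : ℝ ↦ ∑' n : ℕ, residueClass a n / Real.log n / (n : ℝ) ^ x)
      (-∑' n : ℕ, residueClass a n / (n : ℝ) ^ x) x := by
  set f : ℕ → ℂ := fun n ↦ ((residueClass a n / Real.log n : ℝ) : ℂ) with hf
  have hlog : LSeries.logMul f = fun n ↦ ((residueClass a n : ℝ) : ℂ) := by
    funext n
    rw [LSeries.logMul, hf]
    by_cases hn : Real.log n = 0
    · have : residueClass a n = 0 := by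
        refine le_antisymm ((residueClass_le a n).trans ?_) (residueClass_nonneg a n)
        exact vonMangoldt_le_log.trans hn.le
      simp [this]
    · simp only
      rw [← Complex.natCast_log, ← Complex.ofReal_mul, mul_div_cancel₀ _ hn]
  have habs : LSeries.abscissaOfAbsConv f < (x : ℂ).re := by
    rw [← LSeries.abscissaOfAbsConv_logMul, hlog]
    refine lt_of_le_of_lt (abscissaOfAbsConv_residueClass_le_one a) ?_
    simpa using mod_cast hx
  have h := (LSeries_hasDerivAt habs).real_of_complex
  rw [hlog, ← ofReal_tsum_eq_LSeries (residueClass_apply_zero a), ← Complex.ofReal_neg,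
    Complex.ofReal_re] at h
  refine h.congr_of_eventuallyEq (Eventually.of_forall fun y ↦ ?_)
  simp only [hf]
  rw [← ofReal_tsum_eq_LSeries (f := fun n ↦ residueClass a n / Real.log n) (by simp),
    Complex.ofReal_re]

open ArithmeticFunction ArithmeticFunction.vonMangoldt in
theorem abs_tsum_residueClass_div_log_le {k : ℕ} [NeZero k] {a : ZMod k} (ha : IsUnit a) :
    ∃ C : ℝ, ∀ x ∈ Set.Ioc (1 : ℝ) 2,
      |∑' n : ℕ, residueClass a n / Real.log n / (n : ℝ) ^ x
        + (k.totient : ℝ)⁻¹ * Real.log (x - 1)| ≤ C := by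
  obtain ⟨C, hC⟩ := abs_tsum_residueClass_sub_le ha
  set F : ℝ → ℝ := fun x ↦ ∑' n : ℕ, residueClass a n / Real.log n / (n : ℝ) ^ x
        + (k.totient : ℝ)⁻¹ * Real.log (x - 1) with hF
  have hd : ∀ x ∈ Set.Ioc (1 : ℝ) 2, HasDerivWithinAt F
      (-(∑' n, residueClass a n / (n : ℝ) ^ x - (k.totient : ℝ)⁻¹ / (x - 1))) (Set.Ioc 1 2) x := by
    intro x hx
    have h1 := hasDerivAt_tsum_residueClass_div_log a hx.1
    have h2 : HasDerivAt (fun x : ℝ ↦ (k.totient : ℝ)⁻¹ * Real.log (x - 1))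
        ((k.totient : ℝ)⁻¹ * (1 / (x - 1))) x :=
      (((hasDerivAt_id x).sub_const 1).log (sub_ne_zero.mpr hx.1.ne')).const_mul _
    refine ((h1.add h2).congr_deriv ?_).hasDerivWithinAt
    ring
  refine ⟨|F 2| + C, fun x hx ↦ ?_⟩
  have h := (convex_Ioc (1 : ℝ) 2).norm_image_sub_le_of_norm_hasDerivWithin_le hd
    (fun y hy ↦ by rw [norm_neg]; exact hC y hy) (⟨by norm_num, le_rfl⟩ : (2 : ℝ) ∈ Set.Ioc 1 2) hx
  have hx1 : ‖x - 2‖ ≤ 1 := by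
    rw [Real.norm_eq_abs, abs_le]
    constructor <;> linarith [hx.1, hx.2]
  have hC0 : 0 ≤ C := (abs_nonneg _).trans (hC x hx)
  calc |F x| = |F 2 + (F x - F 2)| := by ring_nf
    _ ≤ |F 2| + |F x - F 2| := abs_add_le _ _
    _ ≤ |F 2| + C := by
      gcongr
      exact h.trans (mul_le_of_le_one_right hC0 hx1)

/-- The primes `p ≤ N` with `p ≡ 1 (mod k)`. -/
def primesOne (k N : ℕ) : Finset ℕ :=
  (Finset.range (N + 1)).filter fun p ↦ p.Prime ∧ p % k = 1 % k

/-- The sum of `1 / p` over the primes `p ≤ N` with `p ≡ 1 (mod k)`. -/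
def recipSum (k N : ℕ) : ℝ := ∑ p ∈ primesOne k N, (1 / p : ℝ)

theorem mem_primesOne {k N p : ℕ} :
    p ∈ primesOne k N ↔ p ≤ N ∧ p.Prime ∧ p % k = 1 % k := by
  simp [primesOne]

open ArithmeticFunction ArithmeticFunction.vonMangoldt in
theorem residueClass_one_apply (k n : ℕ) :
    residueClass (1 : ZMod k) n = if n % k = 1 % k then vonMangoldt n else 0 := by
  have : (n : ZMod k) = 1 ↔ n % k = 1 % k := by
    rw [← Nat.cast_one, ZMod.natCast_eq_natCast_iff']
  simp [residueClass, Set.indicator_apply, this]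

theorem one_le_log_of_three_le {N : ℕ} (hN : 3 ≤ N) : 1 ≤ Real.log N := by
  rw [Real.le_log_iff_exp_le (by positivity)]
  have : (3 : ℝ) ≤ N := by exact_mod_cast hN
  linarith [Real.exp_one_lt_d9]

theorem abs_inv_indicator_sub_inv_rpow_le {l : ℝ} (hl : 0 < l) {n : ℝ} (hn : 1 < n) (P : Prop)
    [Decidable P] (hP : P ↔ Real.log n ≤ l) :
    |(if P then 1 / n else 0) - 1 / n ^ (1 + 1 / l)|
      ≤ Real.exp 1 / l * (Real.log n / n ^ (1 + 1 / l)) := by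
  have hn0 : 0 < n := by linarith
  set t := Real.log n / l with ht
  have hlog : 0 < Real.log n := Real.log_pos hn
  have ht0 : 0 < t := div_pos hlog hl
  have hpow : n ^ (1 + 1 / l) = n * Real.exp t := by
    rw [Real.rpow_add hn0, Real.rpow_one, Real.rpow_def_of_pos hn0, ht]
    ring_nf
  have hrhs : Real.exp 1 / l * (Real.log n / n ^ (1 + 1 / l))
      = Real.exp 1 * t * Real.exp (-t) / n := by
    rw [hpow, ht, Real.exp_neg]
    field_simp
  have hexp : 1 / n ^ (1 + 1 / l) = Real.exp (-t) / n := by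
    rw [hpow, Real.exp_neg]
    field_simp
  rw [hrhs, hexp]
  have h1 : 0 < Real.exp (-t) := Real.exp_pos _
  by_cases h : P
  · rw [if_pos h, ← sub_div, abs_div, abs_of_pos hn0]
    have ht1 : t ≤ 1 := by rw [ht, div_le_one hl]; exact hP.mp h
    have h2 : Real.exp (-t) ≤ 1 := Real.exp_le_one_iff.mpr (by linarith)
    have h3 : 1 - t ≤ Real.exp (-t) := by linarith [Real.add_one_le_exp (-t)]
    have h4 : 1 ≤ Real.exp 1 * Real.exp (-t) := by
      rw [← Real.exp_add]; exact Real.one_le_exp (by linarith)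
    gcongr
    rw [abs_of_nonneg (by linarith)]
    nlinarith
  · rw [if_neg h, zero_sub, abs_neg, abs_of_nonneg (by positivity)]
    have ht1 : 1 ≤ t := by
      rw [ht, le_div_iff₀ hl]
      rw [hP] at h
      linarith
    gcongr
    have : 1 ≤ Real.exp 1 * t := by nlinarith [Real.add_one_le_exp 1]
    nlinarith

open ArithmeticFunction ArithmeticFunction.vonMangoldt in
theorem abs_indicator_sub_residueClass_le (k : ℕ) {N : ℕ} (hN : 3 ≤ N) (n : ℕ) :
    |(if n ∈ primesOne k N then 1 / (n : ℝ) else 0)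
        - residueClass (1 : ZMod k) n / Real.log n / (n : ℝ) ^ (1 + 1 / Real.log N)|
      ≤ Real.exp 1 / Real.log N *
          (residueClass (1 : ZMod k) n / (n : ℝ) ^ (1 + 1 / Real.log N))
        + 1 / Real.log 2 * ((if n.Prime then 0 else residueClass (1 : ZMod k) n) / n) := by
  have hR0 : ∀ n, 0 ≤ residueClass (1 : ZMod k) n := residueClass_nonneg _
  set R : ℕ → ℝ := residueClass (1 : ZMod k) with hR
  set l := Real.log N with hl
  have hl0 : 0 < l := zero_lt_one.trans_le (one_le_log_of_three_le hN)
  set x := 1 + 1 / l with hx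
  have hx1 : 1 < x := by rw [hx]; linarith [one_div_pos.mpr hl0]
  have hlog2 : 0 < Real.log 2 := Real.log_pos (by norm_num)
  have hg1 : 0 ≤ Real.exp 1 / l * (R n / (n : ℝ) ^ x) := by
    have := hR0 n
    positivity
  by_cases hp : n.Prime
  · by_cases hm : n % k = 1 % k
    · have hRn : R n = Real.log n := by
        rw [hR, residueClass_one_apply, if_pos hm, vonMangoldt_apply_prime hp]
      have hn1 : (1 : ℝ) < n := by exact_mod_cast hp.one_lt
      have key := abs_inv_indicator_sub_inv_rpow_le hl0 hn1 (n ∈ primesOne k N) (by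
        rw [mem_primesOne, hl, Real.log_le_log_iff (by linarith) (by positivity)]
        simp [hp, hm])
      have hlogn : Real.log n ≠ 0 := (Real.log_pos hn1).ne'
      simp only [hRn, if_pos hp, zero_div, mul_zero, add_zero, div_self hlogn]
      exact key
    · have hRn : R n = 0 := by rw [hR, residueClass_one_apply, if_neg hm]
      have : n ∉ primesOne k N := fun h ↦ hm (mem_primesOne.mp h).2.2
      simp [hRn, this]
  · have : n ∉ primesOne k N := fun h ↦ hp (mem_primesOne.mp h).2.1
    simp only [if_neg this, zero_sub, abs_neg]
    rcases eq_or_ne (R n) 0 with h0 | h0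
    · simp [h0]
    · have hn2 : 2 ≤ n := by
        by_contra hlt
        interval_cases n
        · exact h0 (residueClass_apply_zero 1)
        · refine h0 (le_antisymm ((residueClass_le 1 1).trans ?_) (hR0 1))
          simp
      have hn2' : (2 : ℝ) ≤ n := by exact_mod_cast hn2
      have hlogn : Real.log 2 ≤ Real.log n := Real.log_le_log (by norm_num) hn2'
      have hnx : (n : ℝ) ≤ (n : ℝ) ^ x := by
        conv_lhs => rw [← Real.rpow_one (n : ℝ)]
        exact Real.rpow_le_rpow_of_exponent_le (by linarith) hx1.le
      rw [abs_of_nonneg (by have := hR0 n; have := hlog2.trans_le hlogn; positivity)]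
      calc R n / Real.log n / (n : ℝ) ^ x ≤ R n / Real.log 2 / n := by
            have := hR0 n
            gcongr
        _ = 1 / Real.log 2 * (R n / n) := by ring
        _ ≤ _ := by
            rw [if_neg hp]
            linarith

open ArithmeticFunction ArithmeticFunction.vonMangoldt in
/-- Mertens' theorem for the primes congruent to `1` modulo `k`. -/
theorem abs_recipSum_sub_le (k : ℕ) [NeZero k] :
    ∃ C : ℝ, ∀ N : ℕ, 3 ≤ N → |recipSum k N - (k.totient : ℝ)⁻¹ * LL N| ≤ C := by
  obtain ⟨C₁, hC₁⟩ := abs_tsum_residueClass_sub_le (k := k) (a := 1) isUnit_one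
  obtain ⟨C₂, hC₂⟩ := abs_tsum_residueClass_div_log_le (k := k) (a := 1) isUnit_one
  set R : ℕ → ℝ := residueClass (1 : ZMod k) with hR
  have hR0 : ∀ n, 0 ≤ R n := residueClass_nonneg _
  have hsum := summable_residueClass_non_primes_div (1 : ZMod k)
  set D : ℝ := ∑' n : ℕ, (if n.Prime then 0 else R n) / n with hD
  refine ⟨Real.exp 1 * ((k.totient : ℝ)⁻¹ + C₁) + 1 / Real.log 2 * D + C₂, fun N hN ↦ ?_⟩
  set l := Real.log N with hl
  have hl1 : 1 ≤ l := one_le_log_of_three_le hN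
  have hl0 : 0 < l := by linarith
  set x := 1 + 1 / l with hx
  have hx1 : x ∈ Set.Ioc (1 : ℝ) 2 := by
    have : 1 / l ≤ 1 := by rw [div_le_one hl0]; exact hl1
    exact ⟨by rw [hx]; linarith [one_div_pos.mpr hl0], by rw [hx]; linarith⟩
  have hs1 : Summable fun n : ℕ ↦ R n / (n : ℝ) ^ x := summable_residueClass_div_rpow 1 hx1.1
  set u : ℕ → ℝ := fun n ↦ if n ∈ primesOne k N then 1 / (n : ℝ) else 0 with hu
  set v : ℕ → ℝ := fun n ↦ R n / Real.log n / (n : ℝ) ^ x with hv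
  set g : ℕ → ℝ := fun n ↦ Real.exp 1 / l * (R n / (n : ℝ) ^ x)
    + 1 / Real.log 2 * ((if n.Prime then 0 else R n) / n) with hg
  have hgs : Summable g := (hs1.mul_left _).add (hsum.mul_left _)
  have huv : ∀ n, |u n - v n| ≤ g n := abs_indicator_sub_residueClass_le k hN
  have hus : HasSum u (recipSum k N) := by
    have : recipSum k N = ∑ n ∈ primesOne k N, u n := by
      rw [recipSum]
      exact Finset.sum_congr rfl fun n hn ↦ by simp only [hu, if_pos hn]
    rw [this]
    exact hasSum_sum_of_ne_finset_zero fun n hn ↦ by simp only [hu, if_neg hn]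
  have hduv : Summable fun n ↦ |u n - v n| :=
    Summable.of_nonneg_of_le (fun _ ↦ abs_nonneg _) huv hgs
  have hvs : Summable v := by
    have := hus.summable.sub hduv.of_abs
    simpa using this
  have hdiff : |recipSum k N - ∑' n, v n| ≤ ∑' n, g n := by
    rw [← hus.tsum_eq, ← hus.summable.tsum_sub hvs]
    have h1 : |∑' n, (u n - v n)| ≤ ∑' n, |u n - v n| :=
      norm_tsum_le_tsum_norm (f := fun n ↦ u n - v n) hduv
    exact h1.trans (Summable.tsum_le_tsum huv hduv hgs)
  have hgt : ∑' n, g n ≤ Real.exp 1 * ((k.totient : ℝ)⁻¹ + C₁) + 1 / Real.log 2 * D := by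
    rw [hg, (hs1.mul_left _).tsum_add (hsum.mul_left _), tsum_mul_left, tsum_mul_left]
    gcongr ?_ + _
    have h1 := (abs_le.mp (hC₁ x hx1)).2
    have h2 : (k.totient : ℝ)⁻¹ / (x - 1) = (k.totient : ℝ)⁻¹ * l := by
      rw [hx]
      field_simp
      ring
    have hC0 : 0 ≤ C₁ := (abs_nonneg _).trans (hC₁ x hx1)
    rw [h2] at h1
    rw [div_mul_eq_mul_div, div_le_iff₀ hl0, mul_assoc]
    gcongr
    nlinarith
  have hH := hC₂ x hx1
  have h3 : Real.log (x - 1) = - LL N := by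
    rw [hx, LL, add_sub_cancel_left, one_div, Real.log_inv]
  rw [h3] at hH
  calc |recipSum k N - (k.totient : ℝ)⁻¹ * LL N|
      = |(recipSum k N - ∑' n, v n) + (∑' n, v n + (k.totient : ℝ)⁻¹ * -LL N)| := by ring_nf
    _ ≤ _ := (abs_add_le _ _).trans (add_le_add (hdiff.trans hgt) hH)

theorem ordCompl_factorial_dvd_prod {q : ℕ} (hq : q.Prime) (K : ℕ) :
    ordCompl[q] (K.factorial) ∣ ∏ k ∈ Finset.range K, ((k + 1) * q + 1) := by
  set N := ordCompl[q] (K.factorial) with hN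
  have hcop : q.Coprime N := Nat.coprime_ordCompl hq K.factorial_ne_zero
  rcases Nat.lt_or_ge 1 N with h1 | h1
  · obtain ⟨r, -, hr⟩ := Nat.exists_mul_mod_eq_one_of_coprime hcop h1
    have hr' : q * r ≡ 1 [MOD N] := by rw [Nat.ModEq, hr, Nat.mod_eq_of_lt h1]
    have hrN : N.Coprime r := by
      have h2 : (q * r).Coprime N := by
        have := hr'.gcd_eq
        rw [Nat.Coprime, this]; simp
      exact (Nat.Coprime.coprime_mul_left h2).symm
    have h3 : r ^ K * ∏ k ∈ Finset.range K, ((k + 1) * q + 1)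
        ≡ ∏ k ∈ Finset.range K, (r + 1 + k) [MOD N] := by
      have h4 : r ^ K = ∏ _k ∈ Finset.range K, r := by simp
      rw [h4, ← Finset.prod_mul_distrib]
      refine Nat.ModEq.prod fun k _ ↦ ?_
      have h5 : r * ((k + 1) * q + 1) = (k + 1) * (q * r) + r := by ring
      have h6 : r + 1 + k = (k + 1) * 1 + r := by ring
      rw [h5, h6]
      exact (hr'.mul_left _).add_right _
    rw [← Nat.ascFactorial_eq_prod_range] at h3
    have h7 : N ∣ (r + 1).ascFactorial K :=
      (Nat.ordCompl_dvd _ _).trans (Nat.factorial_dvd_ascFactorial _ _)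
    exact hrN.pow_right K |>.dvd_of_dvd_mul_left ((h3.dvd_iff dvd_rfl).mpr h7)
  · have : N = 1 := le_antisymm h1 (Nat.ordCompl_pos q K.factorial_ne_zero)
    rw [this]; exact one_dvd _

theorem prod_primesOne_le {q : ℕ} (hq : q.Prime) (K : ℕ) :
    ∏ p ∈ (primesOne q (q * K)).filter (K < ·), p ≤ (q * (q + 1)) ^ K := by
  set S := (primesOne q (q * K)).filter (K < ·) with hS
  set A := ∏ k ∈ Finset.range K, ((k + 1) * q + 1) with hA
  set v := K.factorial.factorization q with hv
  have hprime : ∀ p ∈ S, p.Prime := fun p hp ↦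
    (mem_primesOne.mp (Finset.mem_filter.mp hp).1).2.1
  have hPA : ∏ p ∈ S, p ∣ A := by
    refine Finset.prod_primes_dvd _ (fun p hp ↦ (hprime p hp).prime) fun p hp ↦ ?_
    obtain ⟨h1, h2, h3⟩ := mem_primesOne.mp (Finset.mem_filter.mp hp).1
    rw [Nat.mod_eq_of_lt hq.one_lt] at h3
    have h4 := Nat.div_add_mod p q
    rw [h3] at h4
    have h5 : 0 < p / q := by
      rcases Nat.eq_zero_or_pos (p / q) with h | h
      · rw [h] at h4; have := h2.two_le; omega
      · exact h
    have h6 : p / q ≤ K := Nat.div_le_of_le_mul h1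
    have h7 : (p / q - 1 + 1) * q + 1 = p := by
      rw [Nat.sub_add_cancel h5, mul_comm, h4]
    conv_lhs => rw [← h7]
    exact Finset.dvd_prod_of_mem (fun k ↦ (k + 1) * q + 1) (Finset.mem_range.mpr (by omega))
  have hcop : Nat.Coprime (∏ p ∈ S, p) (ordCompl[q] K.factorial) := by
    refine Nat.Coprime.prod_left fun p hp ↦ ?_
    rw [Nat.Prime.coprime_iff_not_dvd (hprime p hp)]
    intro h
    have := ((hprime p hp).dvd_factorial).mp (h.trans (Nat.ordCompl_dvd _ _))
    have := (Finset.mem_filter.mp hp).2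
    omega
  have hdvd := hcop.mul_dvd_of_dvd_of_dvd hPA (ordCompl_factorial_dvd_prod hq K)
  have hApos : 0 < A := Finset.prod_pos fun _ _ ↦ Nat.succ_pos _
  have hle := Nat.le_of_dvd hApos hdvd
  have hvK : v ≤ K := by
    have : Fact q.Prime := ⟨hq⟩
    have := sub_one_mul_padicValNat_factorial (p := q) K
    rw [hv, Nat.factorization_def _ hq]
    have h2 := hq.two_le
    calc padicValNat q K.factorial ≤ (q - 1) * padicValNat q K.factorial :=
          Nat.le_mul_of_pos_left _ (by omega)
      _ ≤ K := by rw [this]; exact Nat.sub_le _ _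
  have hAle : A ≤ K.factorial * (q + 1) ^ K := by
    rw [hA, ← Finset.prod_range_add_one_eq_factorial, ← Finset.card_range K,
      ← Finset.prod_const, Finset.card_range, ← Finset.prod_mul_distrib]
    refine Finset.prod_le_prod' fun k _ ↦ ?_
    nlinarith
  have hfac : q ^ v * ordCompl[q] K.factorial = K.factorial := Nat.ordProj_mul_ordCompl_eq_self _ _
  refine Nat.le_of_mul_le_mul_right ?_ K.factorial_pos
  calc (∏ p ∈ S, p) * K.factorial = q ^ v * ((∏ p ∈ S, p) * ordCompl[q] K.factorial) := by
        conv_lhs => rw [← hfac]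
        ring
    _ ≤ q ^ K * (K.factorial * (q + 1) ^ K) :=
        Nat.mul_le_mul (Nat.pow_le_pow_right hq.pos hvK) (hle.trans hAle)
    _ = (q * (q + 1)) ^ K * K.factorial := by rw [mul_pow]; ring

theorem sum_log_primesOne_le {q : ℕ} (hq : q.Prime) (K : ℕ) :
    ∑ p ∈ (primesOne q (q * K)).filter (K < ·), Real.log p ≤ 3 * K * Real.log q := by
  have h1 : ∏ p ∈ (primesOne q (q * K)).filter (K < ·), p ≤ (q ^ 3) ^ K := by
    refine (prod_primesOne_le hq K).trans (Nat.pow_le_pow_left ?_ K)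
    have := hq.two_le
    nlinarith [sq_nonneg (q - 1), Nat.mul_le_mul this this]
  have hpos : ∀ p ∈ (primesOne q (q * K)).filter (K < ·), (p : ℝ) ≠ 0 := fun p hp ↦
    Nat.cast_ne_zero.mpr (mem_primesOne.mp (Finset.mem_filter.mp hp).1).2.1.ne_zero
  rw [← Real.log_prod hpos]
  have h2 : (∏ p ∈ (primesOne q (q * K)).filter (K < ·), (p : ℝ)) ≤ ((q : ℝ) ^ 3) ^ K := by
    have h3 := (Nat.cast_le (α := ℝ)).mpr h1
    rw [Nat.cast_prod] at h3
    simpa using h3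
  refine (Real.log_le_log ?_ h2).trans_eq ?_
  · exact Finset.prod_pos fun p hp ↦ lt_of_le_of_ne (Nat.cast_nonneg _) (hpos p hp).symm
  · rw [Real.log_pow, Real.log_pow]; push_cast; ring

theorem sum_inv_primesOne_block_le {q : ℕ} (hq : q.Prime) (i : ℕ) :
    ∑ p ∈ (primesOne q (q * 2 ^ (i + 1))).filter (q * 2 ^ i < ·), (1 / p : ℝ)
      ≤ 9 * (Real.log q / q) * (1 / (i + 1)) := by
  have hq2 : 2 ≤ q := hq.two_le
  have hq2' : (2 : ℝ) ≤ q := by exact_mod_cast hq2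
  have hlog2 : 0 < Real.log 2 := Real.log_pos (by norm_num)
  have hlogq : 0 < Real.log q := Real.log_pos (by linarith)
  set D : ℝ := (i + 1) * Real.log 2 * (q * 2 ^ i) with hD
  have hDpos : 0 < D := by positivity
  have hterm : ∀ p ∈ (primesOne q (q * 2 ^ (i + 1))).filter (q * 2 ^ i < ·),
      (1 / p : ℝ) ≤ Real.log p / D := by
    intro p hp
    have h1 : ((q : ℝ) * 2 ^ i) < p := by exact_mod_cast (Finset.mem_filter.mp hp).2
    have h0 : (0 : ℝ) < p := lt_trans (by positivity) h1
    have h2 : (i + 1) * Real.log 2 ≤ Real.log p := by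
      have : (2 : ℝ) ^ (i + 1) ≤ p := by
        rw [pow_succ]
        nlinarith [pow_pos (by norm_num : (0 : ℝ) < 2) i]
      have h3 := Real.log_le_log (by positivity) this
      rwa [Real.log_pow, Nat.cast_add, Nat.cast_one] at h3
    rw [div_le_div_iff₀ h0 hDpos, one_mul, hD]
    exact mul_le_mul h2 h1.le (by positivity) (by positivity)
  have hsub : (primesOne q (q * 2 ^ (i + 1))).filter (q * 2 ^ i < ·)
      ⊆ (primesOne q (q * 2 ^ (i + 1))).filter (2 ^ (i + 1) < ·) := by
    intro p hp
    rw [Finset.mem_filter] at hp ⊢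
    refine ⟨hp.1, lt_of_le_of_lt ?_ hp.2⟩
    rw [pow_succ']
    exact Nat.mul_le_mul_right _ hq2
  have h2log : (0.6931471803 : ℝ) < Real.log 2 := Real.log_two_gt_d9
  calc _ ≤ ∑ p ∈ (primesOne q (q * 2 ^ (i + 1))).filter (q * 2 ^ i < ·), Real.log p / D :=
        Finset.sum_le_sum hterm
    _ ≤ (∑ p ∈ (primesOne q (q * 2 ^ (i + 1))).filter (2 ^ (i + 1) < ·), Real.log p) / D := by
        rw [← Finset.sum_div]
        gcongr ?_ / _
        refine Finset.sum_le_sum_of_subset_of_nonneg hsub fun p hp _ ↦ Real.log_natCast_nonneg p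
    _ ≤ (3 * (2 ^ (i + 1) : ℕ) * Real.log q) / D := by
        gcongr
        exact sum_log_primesOne_le hq _
    _ = 6 / Real.log 2 * (Real.log q / q) * (1 / (i + 1)) := by
        rw [hD]; push_cast; field_simp; ring
    _ ≤ 9 * (Real.log q / q) * (1 / (i + 1)) := by
        gcongr
        rw [div_le_iff₀ hlog2]
        linarith

/-- A Chebyshev-type bound for the primes congruent to `1` modulo a prime `q`, uniform in `q`. -/
theorem recipSum_le {q : ℕ} (hq : q.Prime) {n : ℕ} (hn : 3 ≤ n) :
    recipSum q n ≤ 9 * (Real.log q / q) * (LL n + 3) := by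
  set I := Nat.log 2 n + 1 with hI
  have hq2 : 2 ≤ q := hq.two_le
  have hblock : ∀ p ∈ primesOne q n, p ≤ q * 2 ^ (Nat.log 2 (p / q) + 1) ∧
      q * 2 ^ Nat.log 2 (p / q) < p := by
    intro p hp
    obtain ⟨h1, h2, h3⟩ := mem_primesOne.mp hp
    rw [Nat.mod_eq_of_lt hq.one_lt] at h3
    have h4 := Nat.div_add_mod p q
    rw [h3] at h4
    have h5 : p / q ≠ 0 := by
      intro h
      rw [h] at h4; have := h2.two_le; omega
    have h6 := Nat.pow_log_le_self 2 h5
    have h7 := Nat.lt_pow_succ_log_self (b := 2) one_lt_two (p / q)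
    constructor
    · have : q * (p / q + 1) ≤ q * 2 ^ (Nat.log 2 (p / q) + 1) := Nat.mul_le_mul_left _ h7
      rw [mul_add, mul_one] at this
      omega
    · have := Nat.mul_le_mul_left q h6
      omega
  have hmaps : ∀ p ∈ primesOne q n, Nat.log 2 (p / q) ∈ Finset.range I := by
    intro p hp
    rw [Finset.mem_range, hI, Nat.lt_succ_iff]
    exact Nat.log_mono_right ((Nat.div_le_self _ _).trans (mem_primesOne.mp hp).1)
  have hlogq : 0 ≤ Real.log q := Real.log_natCast_nonneg q
  have hlog1 := one_le_log_of_three_le hn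
  rw [recipSum, ← Finset.sum_fiberwise_of_maps_to hmaps]
  calc _ ≤ ∑ i ∈ Finset.range I, 9 * (Real.log q / q) * (1 / ((i : ℝ) + 1)) := by
        refine Finset.sum_le_sum fun i _ ↦ le_trans ?_ (sum_inv_primesOne_block_le hq i)
        refine Finset.sum_le_sum_of_subset_of_nonneg ?_ fun p _ _ ↦ by positivity
        intro p hp
        rw [Finset.mem_filter] at hp
        obtain ⟨hp, rfl⟩ := hp
        rw [Finset.mem_filter, mem_primesOne]
        exact ⟨⟨(hblock p hp).1, (mem_primesOne.mp hp).2⟩, (hblock p hp).2⟩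
    _ = 9 * (Real.log q / q) * ∑ i ∈ Finset.range I, (1 / ((i : ℝ) + 1)) := by
        rw [Finset.mul_sum]
    _ ≤ 9 * (Real.log q / q) * (LL n + 3) := by
        gcongr
        have h1 : ∑ i ∈ Finset.range I, (1 / ((i : ℝ) + 1)) = (harmonic I : ℝ) := by
          rw [harmonic]; push_cast; simp
        rw [h1]
        refine (harmonic_le_one_add_log I).trans ?_
        have h2 : (I : ℝ) ≤ 3 * Real.log n := by
          have h3 : (Nat.log 2 n : ℝ) * Real.log 2 ≤ Real.log n := by
            have : ((2 : ℝ) ^ Nat.log 2 n) ≤ n := by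
              exact_mod_cast Nat.pow_log_le_self 2 (by omega)
            have := Real.log_le_log (by positivity) this
            rwa [Real.log_pow] at this
          have := Real.log_two_gt_d9
          rw [hI]
          push_cast
          nlinarith [(Nat.cast_nonneg (Nat.log 2 n) : (0 : ℝ) ≤ _)]
        have h4 : Real.log I ≤ Real.log 3 + LL n := by
          rw [LL, ← Real.log_mul (by norm_num) (by linarith)]
          exact Real.log_le_log (by rw [hI]; positivity) h2
        have h5 : Real.log 3 ≤ 2 := by linarith [Real.log_le_sub_one_of_pos (show (0:ℝ) < 3 by norm_num)]
        linarith

theorem tendsto_LL_atTop : Tendsto LL atTop atTop :=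
  Real.tendsto_log_atTop.comp (Real.tendsto_log_atTop.comp tendsto_natCast_atTop_atTop)

open scoped Classical in
theorem cnt_eq_card (P : ℕ → Prop) (n : ℕ) : cnt P n = ((Finset.Icc 1 n).filter P).card := by
  rw [cnt, ← Set.ncard_coe_finset]
  congr 1
  ext m
  simp [and_assoc]

theorem cnt_mono {P Q : ℕ → Prop} {n : ℕ} (h : ∀ m, 1 ≤ m → m ≤ n → P m → Q m) :
    cnt P n ≤ cnt Q n := by
  classical
  rw [cnt_eq_card, cnt_eq_card]
  refine Finset.card_le_card fun m hm ↦ ?_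
  simp only [Finset.mem_filter, Finset.mem_Icc] at hm ⊢
  exact ⟨hm.1, h m hm.1.1 hm.1.2 hm.2⟩

theorem cnt_or_le (P Q : ℕ → Prop) (n : ℕ) :
    cnt (fun m ↦ P m ∨ Q m) n ≤ cnt P n + cnt Q n := by
  classical
  rw [cnt_eq_card, cnt_eq_card, cnt_eq_card]
  refine (Finset.card_le_card fun m hm ↦ ?_).trans (Finset.card_union_le _ _)
  simp only [Finset.mem_filter, Finset.mem_union] at hm ⊢
  tauto

theorem cnt_exists_le {ι : Type*} (s : Finset ι) (P : ι → ℕ → Prop) (n : ℕ) :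
    cnt (fun m ↦ ∃ i ∈ s, P i m) n ≤ ∑ i ∈ s, cnt (P i) n := by
  classical
  simp_rw [cnt_eq_card]
  refine (Finset.card_le_card fun m hm ↦ ?_).trans Finset.card_biUnion_le
  simp only [Finset.mem_filter, Finset.mem_biUnion] at hm ⊢
  obtain ⟨hm, i, hi, h⟩ := hm
  exact ⟨i, hi, hm, h⟩

/-- Markov's inequality for the counting measure on `{1, …, n}`. -/
theorem cnt_le_sum_div {f : ℕ → ℝ} {a : ℝ} (ha : 0 < a) {n : ℕ}
    (hf : ∀ m ∈ Finset.Icc 1 n, 0 ≤ f m) :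
    (cnt (fun m ↦ a ≤ f m) n : ℝ) ≤ (∑ m ∈ Finset.Icc 1 n, f m) / a := by
  classical
  rw [cnt_eq_card, le_div_iff₀ ha, ← nsmul_eq_mul]
  calc _ ≤ ∑ m ∈ (Finset.Icc 1 n).filter (fun m ↦ a ≤ f m), f m :=
        Finset.card_nsmul_le_sum _ _ _ fun m hm ↦ (Finset.mem_filter.mp hm).2
    _ ≤ _ := Finset.sum_le_sum_of_subset_of_nonneg (Finset.filter_subset _ _)
        fun m hm _ ↦ hf m hm

/-- The proportion of `m ∈ {1, …, n}` with `P n m` tends to zero. -/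
def NegDens (P : ℕ → ℕ → Prop) : Prop :=
  Tendsto (fun n ↦ (cnt (P n) n : ℝ) / n) atTop (nhds 0)

theorem NegDens.of_le {P : ℕ → ℕ → Prop} {u : ℕ → ℝ} (hu : Tendsto u atTop (nhds 0))
    (h : ∀ᶠ n : ℕ in atTop, (cnt (P n) n : ℝ) / n ≤ u n) : NegDens P :=
  tendsto_of_tendsto_of_tendsto_of_le_of_le' tendsto_const_nhds hu
    (Eventually.of_forall fun _ ↦ by positivity) h

theorem NegDens.mono {P Q : ℕ → ℕ → Prop} (hQ : NegDens Q)
    (h : ∀ᶠ n : ℕ in atTop, ∀ m, 1 ≤ m → m ≤ n → P n m → Q n m) : NegDens P := by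
  refine NegDens.of_le hQ (h.mono fun n hn ↦ ?_)
  gcongr
  exact cnt_mono hn

theorem NegDens.or {P Q : ℕ → ℕ → Prop} (hP : NegDens P) (hQ : NegDens Q) :
    NegDens fun n m ↦ P n m ∨ Q n m := by
  have h := Tendsto.add hP hQ
  rw [add_zero] at h
  refine NegDens.of_le h (Eventually.of_forall fun n ↦ ?_)
  rw [← add_div]
  gcongr
  exact_mod_cast cnt_or_le _ _ _

theorem NegDens.exists_mem {ι : Type*} (s : Finset ι) {P : ι → ℕ → ℕ → Prop}
    (h : ∀ i ∈ s, NegDens (P i)) : NegDens fun n m ↦ ∃ i ∈ s, P i n m := by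
  have h' : Tendsto (fun n ↦ ∑ i ∈ s, (cnt (P i n) n : ℝ) / n) atTop (nhds 0) := by
    simpa using tendsto_finsetSum s h
  refine NegDens.of_le h' (Eventually.of_forall fun n ↦ ?_)
  rw [← Finset.sum_div]
  gcongr
  have := cnt_exists_le s (fun i ↦ P i n) n
  exact_mod_cast this

/-- The number of elements of `S` dividing `m`. -/
def divCount (S : Finset ℕ) (m : ℕ) : ℕ := (S.filter (· ∣ m)).card

theorem card_Icc_filter_dvd (n d : ℕ) : ((Finset.Icc 1 n).filter (d ∣ ·)).card = n / d := by
  rw [← Nat.Ioc_filter_dvd_card_eq_div n d]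
  rfl

theorem sum_divCount (S : Finset ℕ) (n : ℕ) :
    ∑ m ∈ Finset.Icc 1 n, divCount S m = ∑ p ∈ S, n / p := by
  simp_rw [divCount, Finset.card_filter]
  rw [Finset.sum_comm]
  refine Finset.sum_congr rfl fun p _ ↦ ?_
  rw [← Finset.card_filter, card_Icc_filter_dvd]

theorem sum_divCount_le (S : Finset ℕ) (n : ℕ) :
    ∑ m ∈ Finset.Icc 1 n, (divCount S m : ℝ) ≤ n * ∑ p ∈ S, (1 / p : ℝ) := by
  rw [← Nat.cast_sum, sum_divCount, Nat.cast_sum, Finset.mul_sum]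
  refine Finset.sum_le_sum fun p _ ↦ ?_
  rw [mul_one_div]
  exact Nat.cast_div_le

theorem le_sum_divCount (S : Finset ℕ) (n : ℕ) :
    n * ∑ p ∈ S, (1 / p : ℝ) - S.card ≤ ∑ m ∈ Finset.Icc 1 n, (divCount S m : ℝ) := by
  rw [← Nat.cast_sum, sum_divCount, Nat.cast_sum, Finset.mul_sum, Finset.cast_card,
    ← Finset.sum_sub_distrib]
  refine Finset.sum_le_sum fun p _ ↦ ?_
  rw [mul_one_div]
  have h := Nat.sub_one_lt_floor ((n : ℝ) / p)
  rw [Nat.floor_div_natCast, Nat.floor_natCast] at h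
  exact h.le

theorem sum_divCount_mul_pred_le {S : Finset ℕ} (hS : ∀ p ∈ S, p.Prime) (n : ℕ) :
    ∑ m ∈ Finset.Icc 1 n, ((divCount S m : ℝ) * (divCount S m - 1))
      ≤ n * (∑ p ∈ S, (1 / p : ℝ)) ^ 2 := by
  have h1 : ∀ m, (divCount S m : ℝ) * (divCount S m - 1)
      = ((S.offDiag.filter fun x ↦ x.1 ∣ m ∧ x.2 ∣ m).card : ℝ) := by
    intro m
    have h2 : (S.offDiag.filter fun x ↦ x.1 ∣ m ∧ x.2 ∣ m) = (S.filter (· ∣ m)).offDiag := by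
      ext x
      simp only [Finset.mem_filter, Finset.mem_offDiag]
      tauto
    rw [h2, Finset.offDiag_card, divCount, Nat.cast_sub (Nat.le_mul_self _)]
    push_cast
    ring
  simp_rw [h1]
  rw [← Nat.cast_sum]
  simp_rw [Finset.card_filter]
  rw [Finset.sum_comm]
  have h3 : ∀ x ∈ S.offDiag,
      ∑ m ∈ Finset.Icc 1 n, (if x.1 ∣ m ∧ x.2 ∣ m then 1 else 0) = n / (x.1 * x.2) := by
    intro x hx
    rw [Finset.mem_offDiag] at hx
    rw [← Finset.card_filter, ← card_Icc_filter_dvd]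
    congr 1
    refine Finset.filter_congr fun m _ ↦ ?_
    have hc := (Nat.coprime_primes (hS _ hx.1) (hS _ hx.2.1)).mpr hx.2.2
    exact ⟨fun h ↦ hc.mul_dvd_of_dvd_of_dvd h.1 h.2,
      fun h ↦ ⟨dvd_of_mul_right_dvd h, dvd_of_mul_left_dvd h⟩⟩
  rw [Finset.sum_congr rfl h3, Nat.cast_sum, sq, Finset.sum_mul_sum, ← Finset.sum_product',
    Finset.mul_sum]
  calc _ ≤ ∑ x ∈ S.offDiag, (n : ℝ) * ((1 / x.1 : ℝ) * (1 / x.2)) := by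
        refine Finset.sum_le_sum fun x _ ↦ Nat.cast_div_le.trans_eq ?_
        push_cast
        ring
    _ ≤ _ := by
        refine Finset.sum_le_sum_of_subset_of_nonneg ?_ fun x _ _ ↦ by positivity
        intro x hx
        rw [Finset.mem_offDiag] at hx
        exact Finset.mem_product.mpr ⟨hx.1, hx.2.1⟩

/-- The Turán–Kubilius inequality for the number of prime divisors in a set of primes. -/
theorem sum_divCount_sub_sq_le {S : Finset ℕ} (hS : ∀ p ∈ S, p.Prime) {n : ℕ} (hn : S.card ≤ n) :
    ∑ m ∈ Finset.Icc 1 n, ((divCount S m : ℝ) - ∑ p ∈ S, (1 / p : ℝ)) ^ 2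
      ≤ n * (3 * ∑ p ∈ S, (1 / p : ℝ)) := by
  set R := ∑ p ∈ S, (1 / p : ℝ) with hR
  have hR0 : 0 ≤ R := Finset.sum_nonneg fun _ _ ↦ by positivity
  have h1 := sum_divCount_mul_pred_le hS n
  have h2 := sum_divCount_le S n
  have h3 := le_sum_divCount S n
  rw [← hR] at h1 h2 h3
  have h4 : ∑ m ∈ Finset.Icc 1 n, ((divCount S m : ℝ) - R) ^ 2
      = ∑ m ∈ Finset.Icc 1 n, ((divCount S m : ℝ) * (divCount S m - 1))
        + (1 - 2 * R) * ∑ m ∈ Finset.Icc 1 n, (divCount S m : ℝ) + n * R ^ 2 := by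
    have h5 : (n : ℝ) * R ^ 2 = ∑ m ∈ Finset.Icc 1 n, R ^ 2 := by simp
    rw [h5, Finset.mul_sum, ← Finset.sum_add_distrib, ← Finset.sum_add_distrib]
    exact Finset.sum_congr rfl fun _ _ ↦ by ring
  have hn' : (S.card : ℝ) ≤ n := by exact_mod_cast hn
  rw [h4]
  nlinarith [mul_le_mul_of_nonneg_left h3 hR0, mul_le_mul_of_nonneg_left hn' hR0]

theorem omegaQ_eq_divCount {m n : ℕ} (hm : 1 ≤ m) (hmn : m ≤ n) (q : ℕ) :
    omegaQ m q = divCount (primesOne q n) m := by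
  rw [omegaQ, divCount]
  congr 1
  ext p
  simp only [Finset.mem_filter, Nat.mem_primeFactors, mem_primesOne]
  constructor
  · rintro ⟨⟨h1, h2, h3⟩, h4⟩
    exact ⟨⟨(Nat.le_of_dvd hm h2).trans hmn, h1, h4⟩, h2⟩
  · rintro ⟨⟨h1, h2, h3⟩, h4⟩
    exact ⟨⟨h2, h4, by omega⟩, h3⟩

theorem card_primesOne_le (q n : ℕ) : (primesOne q n).card ≤ n := by
  have : primesOne q n ⊆ Finset.Icc 1 n := fun p hp ↦ by
    have := mem_primesOne.mp hp
    exact Finset.mem_Icc.mpr ⟨this.2.1.one_lt.le, this.1⟩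
  simpa using Finset.card_le_card this

theorem prime_of_mem_primesOne {q n p : ℕ} (hp : p ∈ primesOne q n) : p.Prime :=
  (mem_primesOne.mp hp).2.1

/-- For almost all `m`, the number of prime divisors congruent to `1` modulo `q` is close
to `log log n / φ(q)`. -/
theorem negDens_omegaQ (q : ℕ) [NeZero q] {η : ℝ} (hη : 0 < η) :
    NegDens fun n m ↦ η * LL n ≤ |(omegaQ m q : ℝ) - (q.totient : ℝ)⁻¹ * LL n| := by
  obtain ⟨C, hC⟩ := abs_recipSum_sub_le q
  have hu : Tendsto (fun n : ℕ ↦ (12 * (C + 1) / η ^ 2) / LL n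
      + (12 * (q.totient : ℝ)⁻¹ / η ^ 2) / LL n) atTop (nhds 0) := by
    simpa using (tendsto_LL_atTop.const_div_atTop _).add (tendsto_LL_atTop.const_div_atTop _)
  refine NegDens.of_le hu ?_
  filter_upwards [eventually_ge_atTop 3, tendsto_LL_atTop.eventually_ge_atTop (2 * C / η),
    tendsto_LL_atTop.eventually_ge_atTop 1] with n hn hL hL1
  have hL0 : 0 < LL n := by linarith
  have hn0 : (0 : ℝ) < n := by positivity
  set R := recipSum q n with hR
  have hRC := abs_le.mp (hC n hn)
  rw [div_le_iff₀' hη] at hL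
  have hsub : cnt (fun m ↦ η * LL n ≤ |(omegaQ m q : ℝ) - (q.totient : ℝ)⁻¹ * LL n|) n
      ≤ cnt (fun m ↦ (η * LL n / 2) ^ 2 ≤ ((divCount (primesOne q n) m : ℝ) - R) ^ 2) n := by
    refine cnt_mono fun m hm hmn h ↦ ?_
    rw [omegaQ_eq_divCount hm hmn] at h
    rw [← sq_abs ((divCount (primesOne q n) m : ℝ) - R)]
    have h2 := abs_sub_le (divCount (primesOne q n) m : ℝ) R ((q.totient : ℝ)⁻¹ * LL n)
    have h3 := hC n hn
    have h4 : 0 ≤ η * LL n / 2 := by positivity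
    exact pow_le_pow_left₀ h4 (by linarith) 2
  have hmark := cnt_le_sum_div (f := fun m ↦ ((divCount (primesOne q n) m : ℝ) - R) ^ 2)
    (a := (η * LL n / 2) ^ 2) (by positivity) (n := n) (fun m _ ↦ sq_nonneg _)
  have hT := sum_divCount_sub_sq_le (S := primesOne q n) (fun p hp ↦ prime_of_mem_primesOne hp)
    (card_primesOne_le q n)
  have hT' : ∑ m ∈ Finset.Icc 1 n, ((divCount (primesOne q n) m : ℝ) - R) ^ 2
      ≤ n * (3 * R) := hT
  calc (cnt _ n : ℝ) / n
      ≤ (n * (3 * R) / (η * LL n / 2) ^ 2) / n := by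
        gcongr
        exact (Nat.cast_le.mpr hsub).trans (hmark.trans (by gcongr))
    _ = 12 * R / (η ^ 2 * LL n ^ 2) := by field_simp; ring
    _ ≤ 12 * ((C + 1) * LL n + (q.totient : ℝ)⁻¹ * LL n) / (η ^ 2 * LL n ^ 2) := by
        gcongr
        have hC0 : 0 ≤ C := (abs_nonneg _).trans (hC n hn)
        nlinarith [hRC.2]
    _ = _ := by field_simp

theorem summable_log_div_sq : Summable fun q : ℕ ↦ (Real.log q / q) ^ 2 := by
  have h : Summable fun q : ℕ ↦ 16 * (1 / (q : ℝ) ^ (3 / 2 : ℝ)) :=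
    (Real.summable_one_div_nat_rpow.mpr (by norm_num)).mul_left _
  refine Summable.of_nonneg_of_le (fun _ ↦ sq_nonneg _) (fun q ↦ ?_) h
  rcases Nat.eq_zero_or_pos q with rfl | hq
  · simp
  · have hq0 : (0 : ℝ) < q := by exact_mod_cast hq
    have h1 : Real.log q ≤ (q : ℝ) ^ (1 / 4 : ℝ) / (1 / 4) :=
      Real.log_le_rpow_div hq0.le (by norm_num)
    have h2 : 0 ≤ Real.log q := Real.log_natCast_nonneg q
    have h3 : ((q : ℝ) ^ (1 / 4 : ℝ)) ^ 2 = (q : ℝ) ^ (1 / 2 : ℝ) := by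
      rw [← Real.rpow_natCast, ← Real.rpow_mul hq0.le]; norm_num
    have h4 : (q : ℝ) ^ 2 = (q : ℝ) ^ (1 / 2 : ℝ) * (q : ℝ) ^ (3 / 2 : ℝ) := by
      rw [← Real.rpow_add hq0]; norm_num
    have h5 : 0 < (q : ℝ) ^ (1 / 2 : ℝ) := by positivity
    calc (Real.log q / q) ^ 2 ≤ ((q : ℝ) ^ (1 / 4 : ℝ) / (1 / 4) / q) ^ 2 := by gcongr
      _ = 16 * ((q : ℝ) ^ (1 / 4 : ℝ)) ^ 2 / (q : ℝ) ^ 2 := by ring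
      _ = _ := by rw [h3, h4]; field_simp

theorem NegDens.of_forall {P : ℕ → ℕ → Prop}
    (h : ∀ ε > 0, ∀ᶠ n : ℕ in atTop, (cnt (P n) n : ℝ) / n ≤ ε) : NegDens P := by
  refine Metric.tendsto_atTop'.mpr fun ε hε ↦ ?_
  obtain ⟨N, hN⟩ := eventually_atTop.mp (h (ε / 2) (by positivity))
  refine ⟨N, fun n hn ↦ ?_⟩
  rw [Real.dist_eq, sub_zero, abs_of_nonneg (by positivity)]
  linarith [hN n hn.le]

theorem NegDens.eventually_le {P : ℕ → ℕ → Prop} (h : NegDens P) {ε : ℝ} (hε : 0 < ε) :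
    ∀ᶠ n : ℕ in atTop, (cnt (P n) n : ℝ) / n ≤ ε :=
  (h.eventually_lt_const hε).mono fun _ ↦ le_of_lt

theorem cnt_le_omegaQ_le {q : ℕ} (hq : q.Prime) {n : ℕ} (hn : 3 ≤ n) (hL : 10 ≤ LL n) :
    (cnt (fun m ↦ 1 / 5 * LL n ≤ omegaQ m q) n : ℝ) ≤ n * (8100 * (Real.log q / q) ^ 2) := by
  set L := LL n with hLdef
  have ha : 0 < 1 / 5 * L * (1 / 5 * L - 1) := mul_pos (by linarith) (by linarith)
  have h1 : cnt (fun m ↦ 1 / 5 * L ≤ omegaQ m q) n ≤ cnt (fun m ↦ 1 / 5 * L * (1 / 5 * L - 1) ≤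
      (divCount (primesOne q n) m : ℝ) * (divCount (primesOne q n) m - 1)) n := by
    refine cnt_mono fun m hm hmn h ↦ ?_
    rw [omegaQ_eq_divCount hm hmn] at h
    exact mul_le_mul h (by linarith) (by linarith) (by positivity)
  have h2 := cnt_le_sum_div (f := fun m ↦ (divCount (primesOne q n) m : ℝ) *
    (divCount (primesOne q n) m - 1)) ha (n := n) fun m _ ↦ by
      rcases Nat.eq_zero_or_pos (divCount (primesOne q n) m) with h | h
      · simp [h]
      · have : (1 : ℝ) ≤ divCount (primesOne q n) m := by exact_mod_cast h
        exact mul_nonneg (by linarith) (by linarith)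
  have h3 : _ ≤ n * (recipSum q n) ^ 2 :=
    sum_divCount_mul_pred_le (S := primesOne q n) (fun p hp ↦ prime_of_mem_primesOne hp) n
  have h4 := recipSum_le hq hn
  have h5 : 0 ≤ recipSum q n := Finset.sum_nonneg fun _ _ ↦ by positivity
  have h6 : 0 ≤ Real.log q := Real.log_natCast_nonneg q
  set l := Real.log q / q with hl
  have hl0 : 0 ≤ l := by positivity
  calc (cnt _ n : ℝ) ≤ _ := Nat.cast_le.mpr h1
    _ ≤ _ := h2
    _ ≤ n * (9 * l * (L + 3)) ^ 2 / (1 / 5 * L * (1 / 5 * L - 1)) := by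
        refine div_le_div_of_nonneg_right (h3.trans ?_) ha.le
        gcongr
    _ ≤ _ := by
        rw [div_le_iff₀ ha]
        have : (9 * (L + 3)) ^ 2 ≤ 8100 * (1 / 5 * L * (1 / 5 * L - 1)) := by nlinarith
        have h7 : 0 ≤ (n : ℝ) * l ^ 2 := by positivity
        nlinarith [mul_le_mul_of_nonneg_left this h7]

theorem le_of_omegaQ_pos {q m n : ℕ} (hq : q.Prime) (hm : 1 ≤ m) (hmn : m ≤ n)
    (h : 0 < omegaQ m q) : q ≤ n := by
  rw [omegaQ, Finset.card_pos] at h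
  obtain ⟨p, hp⟩ := h
  simp only [Finset.mem_filter, Nat.mem_primeFactors] at hp
  obtain ⟨⟨hp1, hp2, hp3⟩, hp4⟩ := hp
  have hpn : p ≤ n := (Nat.le_of_dvd hm hp2).trans hmn
  by_contra! hqn
  rw [Nat.mod_eq_of_lt (by omega), Nat.mod_eq_of_lt hq.one_lt] at hp4
  exact hp1.one_lt.ne' hp4

theorem negDens_exists_prime_omegaQ :
    NegDens fun n m ↦ ∃ q : ℕ, q.Prime ∧ 7 ≤ q ∧ 1 / 5 * LL n ≤ omegaQ m q := by
  refine NegDens.of_forall fun ε hε ↦ ?_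
  obtain ⟨s, hs⟩ := summable_iff_vanishing_norm.mp summable_log_div_sq (ε / 2 / 8100) (by positivity)
  have hsmall : NegDens fun n m ↦ ∃ q ∈ s.filter (fun q ↦ q.Prime ∧ 7 ≤ q),
      1 / 5 * LL n ≤ (omegaQ m q : ℝ) := by
    refine NegDens.exists_mem (P := fun q n m ↦ 1 / 5 * LL n ≤ (omegaQ m q : ℝ)) _ fun q hq ↦ ?_
    rw [Finset.mem_filter] at hq
    have : NeZero q := ⟨hq.2.1.ne_zero⟩
    refine (negDens_omegaQ q (η := 1 / 30) (by norm_num)).mono ?_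
    filter_upwards [tendsto_LL_atTop.eventually_ge_atTop 0] with n hn m _ _ h
    refine le_trans ?_ (le_abs_self _)
    have h6 : (6 : ℝ) ≤ q.totient := by
      rw [Nat.totient_prime hq.2.1]
      exact_mod_cast Nat.le_sub_one_of_lt hq.2.2
    have : (q.totient : ℝ)⁻¹ ≤ 1 / 6 := by
      rw [← one_div]; gcongr
    nlinarith
  filter_upwards [hsmall.eventually_le (ε := ε / 2) (by positivity), eventually_ge_atTop 3,
    tendsto_LL_atTop.eventually_ge_atTop 10] with n h1 hn hL
  set t := (Finset.range (n + 1)).filter (fun q ↦ q.Prime ∧ q ∉ s) with ht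
  have hn0 : (0 : ℝ) < n := by positivity
  have hle : cnt (fun m ↦ ∃ q : ℕ, q.Prime ∧ 7 ≤ q ∧ 1 / 5 * LL n ≤ omegaQ m q) n
      ≤ cnt (fun m ↦ (∃ q ∈ s.filter (fun q ↦ q.Prime ∧ 7 ≤ q),
        1 / 5 * LL n ≤ (omegaQ m q : ℝ)) ∨ ∃ q ∈ t, 1 / 5 * LL n ≤ (omegaQ m q : ℝ)) n := by
    refine cnt_mono fun m hm hmn ⟨q, hq, hq7, h⟩ ↦ ?_
    by_cases hqs : q ∈ s
    · exact Or.inl ⟨q, by simp [hqs, hq, hq7], h⟩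
    · refine Or.inr ⟨q, ?_, h⟩
      have h0 : (0 : ℝ) < omegaQ m q := by linarith
      have := le_of_omegaQ_pos hq hm hmn (by exact_mod_cast h0)
      simp only [ht, Finset.mem_filter, Finset.mem_range]
      exact ⟨by omega, hq, hqs⟩
  have h2 : (cnt (fun m ↦ ∃ q ∈ t, 1 / 5 * LL n ≤ (omegaQ m q : ℝ)) n : ℝ) ≤ n * (ε / 2) := by
    have h3 := cnt_exists_le t (fun q m ↦ 1 / 5 * LL n ≤ (omegaQ m q : ℝ)) n
    have h4 := hs t (Finset.disjoint_left.mpr fun q hq ↦ (Finset.mem_filter.mp hq).2.2)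
    rw [Real.norm_of_nonneg (Finset.sum_nonneg fun _ _ ↦ sq_nonneg _)] at h4
    calc _ ≤ ((∑ q ∈ t, cnt (fun m ↦ 1 / 5 * LL n ≤ (omegaQ m q : ℝ)) n : ℕ) : ℝ) :=
          Nat.cast_le.mpr h3
      _ ≤ ∑ q ∈ t, n * (8100 * (Real.log q / q) ^ 2) := by
          rw [Nat.cast_sum]
          exact Finset.sum_le_sum fun q hq ↦ cnt_le_omegaQ_le (Finset.mem_filter.mp hq).2.1 hn hL
      _ = n * (8100 * ∑ q ∈ t, (Real.log q / q) ^ 2) := by simp_rw [Finset.mul_sum]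
      _ ≤ _ := by gcongr; linarith
  have h5 := (Nat.cast_le (α := ℝ)).mpr (hle.trans (cnt_or_le _ _ n))
  rw [div_le_iff₀ hn0] at h1 ⊢
  push_cast at h5
  linarith

theorem card_powerset_filter_card_le (S : Finset ℕ) (K : ℕ) :
    (S.powerset.filter fun T ↦ T.card ≤ K).card ≤ (S.card + 1) ^ K := by
  have h : S.powerset.filter (fun T ↦ T.card ≤ K)
      = (Finset.range (K + 1)).biUnion fun i ↦ Finset.powersetCard i S := by
    ext T
    simp only [Finset.mem_filter, Finset.mem_powerset, Finset.mem_biUnion, Finset.mem_range,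
      Finset.mem_powersetCard]
    exact ⟨fun h ↦ ⟨T.card, by omega, h.1, rfl⟩, fun ⟨i, hi, h1, h2⟩ ↦ ⟨h1, by omega⟩⟩
  rw [h, add_pow]
  refine Finset.card_biUnion_le.trans (Finset.sum_le_sum fun i hi ↦ ?_)
  rw [Finset.card_powersetCard, one_pow, mul_one]
  calc S.card.choose i ≤ S.card ^ i := Nat.choose_le_pow _ _
    _ ≤ _ := Nat.le_mul_of_pos_right _ (Nat.choose_pos (by simpa [Nat.lt_succ_iff] using hi))

theorem forall_dvd_iff_prod_dvd {S T : Finset ℕ} (hS : ∀ p ∈ S, p.Prime) (hT : T ⊆ S) (m : ℕ) :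
    (∀ p ∈ T, p ∣ m) ↔ ∏ p ∈ T, p ∣ m :=
  ⟨fun h ↦ Finset.prod_primes_dvd m (fun p hp ↦ (hS p (hT hp)).prime) h,
    fun h _ hp ↦ (Finset.dvd_prod_of_mem _ hp).trans h⟩

theorem sum_prod_filter_dvd {S : Finset ℕ} (hS : ∀ p ∈ S, p.Prime) (w : ℕ → ℂ) (n : ℕ) :
    ∑ m ∈ Finset.Icc 1 n, ∏ p ∈ S.filter (· ∣ m), (1 + w p)
      = ∑ T ∈ S.powerset, (∏ p ∈ T, w p) * ((n / ∏ p ∈ T, p : ℕ) : ℂ) := by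
  have h (m : ℕ) : ∏ p ∈ S.filter (· ∣ m), (1 + w p)
      = ∑ T ∈ S.powerset, (∏ p ∈ T, w p) * (if ∏ p ∈ T, p ∣ m then 1 else 0) := by
    rw [Finset.prod_one_add]
    simp_rw [mul_ite, mul_one, mul_zero]
    rw [← Finset.sum_filter]
    refine Finset.sum_congr ?_ fun _ _ ↦ rfl
    ext T
    simp only [Finset.mem_powerset, Finset.mem_filter]
    constructor
    · intro hT
      have h1 : T ⊆ S := hT.trans (Finset.filter_subset _ _)
      exact ⟨h1, (forall_dvd_iff_prod_dvd hS h1 m).mp fun p hp ↦ (Finset.mem_filter.mp (hT hp)).2⟩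
    · rintro ⟨h1, h2⟩ p hp
      exact Finset.mem_filter.mpr ⟨h1 hp, (forall_dvd_iff_prod_dvd hS h1 m).mpr h2 p hp⟩
  simp_rw [h]
  rw [Finset.sum_comm]
  refine Finset.sum_congr rfl fun T _ ↦ ?_
  rw [← Finset.mul_sum, ← card_Icc_filter_dvd, Finset.card_filter]
  push_cast
  rfl

theorem norm_floor_div_sub_le {n d : ℕ} (hn : 0 < n) :
    ‖((n / d : ℕ) : ℂ) / n - 1 / d‖ ≤ 1 / n ∧ ‖((n / d : ℕ) : ℂ) / n - 1 / d‖ ≤ 1 / d := by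
  have hn0 : (0 : ℝ) < n := by exact_mod_cast hn
  have e : ((n / d : ℕ) : ℂ) / n - 1 / d = (((n / d : ℕ) : ℝ) / n - 1 / d : ℝ) := by push_cast; rfl
  have h1 : ((n / d : ℕ) : ℝ) ≤ n / d := Nat.cast_div_le
  have h2 := Nat.sub_one_lt_floor ((n : ℝ) / d)
  rw [Nat.floor_div_natCast, Nat.floor_natCast] at h2
  have h3 : (0 : ℝ) ≤ ((n / d : ℕ) : ℝ) / n := by positivity
  have h4 : ((n / d : ℕ) : ℝ) / n ≤ 1 / d := by
    rw [div_le_iff₀ hn0]; rw [one_div_mul_eq_div]; exact h1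
  have h5 : (1 : ℝ) / d - 1 / n ≤ ((n / d : ℕ) : ℝ) / n := by
    rw [le_div_iff₀ hn0, sub_mul, one_div_mul_eq_div, one_div_mul_cancel hn0.ne']
    exact h2.le
  rw [e, Complex.norm_real, Real.norm_eq_abs, abs_sub_comm, abs_of_nonneg (by linarith)]
  exact ⟨by linarith, by linarith⟩

/-- Averages of multiplicative functions supported on a small set of primes factor, up to a small
error. -/
theorem norm_average_prod_sub_prod_le {S : Finset ℕ} (hS : ∀ p ∈ S, p.Prime) {w : ℕ → ℂ} {δ : ℝ}
    (hδ : 0 ≤ δ) (hδ1 : δ ≤ 1) (hw : ∀ p ∈ S, ‖w p‖ ≤ δ) (K : ℕ) {n : ℕ} (hn : 0 < n) :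
    ‖(∑ m ∈ Finset.Icc 1 n, ∏ p ∈ S.filter (· ∣ m), (1 + w p)) / n - ∏ p ∈ S, (1 + w p / p)‖
      ≤ (S.card + 1 : ℝ) ^ K / n + (1 / 2) ^ K * Real.exp (2 * δ * ∑ p ∈ S, (1 / p : ℝ)) := by
  have hn0 : (0 : ℝ) < n := by exact_mod_cast hn
  have h1 : (∑ m ∈ Finset.Icc 1 n, ∏ p ∈ S.filter (· ∣ m), (1 + w p)) / n - ∏ p ∈ S, (1 + w p / p)
      = ∑ T ∈ S.powerset, (∏ p ∈ T, w p) *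
        (((n / ∏ p ∈ T, p : ℕ) : ℂ) / n - 1 / ((∏ p ∈ T, p : ℕ) : ℂ)) := by
    rw [sum_prod_filter_dvd hS, Finset.prod_one_add, Finset.sum_div, ← Finset.sum_sub_distrib]
    refine Finset.sum_congr rfl fun T _ ↦ ?_
    rw [Finset.prod_div_distrib]
    push_cast
    ring
  have h2 : ∀ T ∈ S.powerset, ‖(∏ p ∈ T, w p) *
        (((n / ∏ p ∈ T, p : ℕ) : ℂ) / n - 1 / ((∏ p ∈ T, p : ℕ) : ℂ))‖
      ≤ (if T.card ≤ K then 1 / (n : ℝ) else 0) + (1 / 2) ^ K * ∏ p ∈ T, (2 * δ * (1 / p : ℝ)) := by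
    intro T hT
    rw [Finset.mem_powerset] at hT
    have hwT : ‖∏ p ∈ T, w p‖ ≤ δ ^ T.card := by
      rw [norm_prod]
      exact (Finset.prod_le_prod (fun _ _ ↦ norm_nonneg _) fun p hp ↦ hw p (hT hp)).trans_eq
        (by simp)
    have hd := norm_floor_div_sub_le (d := ∏ p ∈ T, p) hn
    have hprod : ∏ p ∈ T, (2 * δ * (1 / p : ℝ))
        = 2 ^ T.card * (δ ^ T.card * (1 / ((∏ p ∈ T, p : ℕ) : ℝ))) := by
      rw [Finset.prod_mul_distrib, Finset.prod_const, Finset.prod_div_distrib, mul_pow]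
      push_cast
      simp only [Finset.prod_const_one]
      ring
    rw [norm_mul]
    split_ifs with hK
    · have : 0 ≤ (1 / 2 : ℝ) ^ K * ∏ p ∈ T, (2 * δ * (1 / p : ℝ)) :=
        mul_nonneg (by positivity) (Finset.prod_nonneg fun _ _ ↦ by positivity)
      have h3 : ‖∏ p ∈ T, w p‖ ≤ 1 := hwT.trans (pow_le_one₀ hδ hδ1)
      have h4 := mul_le_mul h3 hd.1 (norm_nonneg _) zero_le_one
      linarith
    · rw [zero_add, hprod]
      have h5 : (1 : ℝ) ≤ (1 / 2) ^ K * 2 ^ T.card := by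
        rw [one_div, inv_pow, inv_mul_eq_div, one_le_div (by positivity)]
        exact pow_le_pow_right₀ (by norm_num) (by omega)
      calc _ ≤ δ ^ T.card * (1 / ((∏ p ∈ T, p : ℕ) : ℝ)) :=
            mul_le_mul hwT hd.2 (norm_nonneg _) (by positivity)
        _ ≤ ((1 / 2) ^ K * 2 ^ T.card) * (δ ^ T.card * (1 / ((∏ p ∈ T, p : ℕ) : ℝ))) :=
            le_mul_of_one_le_left (by positivity) h5
        _ = _ := by ring
  rw [h1]
  refine (norm_sum_le_of_le _ h2).trans ?_
  rw [Finset.sum_add_distrib, ← Finset.mul_sum, ← Finset.prod_one_add, ← Finset.sum_filter,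
    Finset.sum_const, nsmul_eq_mul, mul_one_div]
  gcongr
  · exact_mod_cast card_powerset_filter_card_le S K
  · rw [Finset.mul_sum, Real.exp_sum]
    refine Finset.prod_le_prod (fun _ _ ↦ by positivity) fun p _ ↦ ?_
    rw [add_comm]
    exact Real.add_one_le_exp _

/-- The sieving level: primes up to `truncLevel n` are kept. -/
def truncLevel (n : ℕ) : ℕ := ⌊Real.exp (Real.log n / (2 * ⌈LL n⌉₊))⌋₊

theorem exp_LL {n : ℕ} (hn : 3 ≤ n) : Real.exp (LL n) = Real.log n :=
  Real.exp_log (zero_lt_one.trans_le (one_le_log_of_three_le hn))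

theorem two_le_log_div {n : ℕ} (hn : 3 ≤ n) (hL : 4 ≤ LL n) :
    2 ≤ Real.log n / (2 * ⌈LL n⌉₊) := by
  have h1 : (⌈LL n⌉₊ : ℝ) < LL n + 1 := Nat.ceil_lt_add_one (by linarith)
  have h2 : (0 : ℝ) < ⌈LL n⌉₊ := lt_of_lt_of_le (by linarith) (Nat.le_ceil (LL n))
  rw [le_div_iff₀ (by positivity), ← exp_LL hn]
  have h3 : 1 + LL n + LL n ^ 2 / 2 + LL n ^ 3 / 6 ≤ Real.exp (LL n) := by
    have := Real.sum_le_exp_of_nonneg (x := LL n) (by linarith) 4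
    simpa [Finset.sum_range_succ, Nat.factorial] using this
  nlinarith

theorem truncLevel_le_exp (n : ℕ) :
    (truncLevel n : ℝ) ≤ Real.exp (Real.log n / (2 * ⌈LL n⌉₊)) :=
  Nat.floor_le (Real.exp_pos _).le

theorem truncLevel_le {n : ℕ} (hn : 3 ≤ n) (hL : 4 ≤ LL n) : truncLevel n ≤ n := by
  have h := truncLevel_le_exp n
  have hn0 : (0 : ℝ) < n := by positivity
  have h2 : (1 : ℝ) ≤ ⌈LL n⌉₊ := le_trans (by linarith) (Nat.le_ceil (LL n))
  have h3 : Real.log n / (2 * ⌈LL n⌉₊) ≤ Real.log n :=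
    div_le_self (zero_le_one.trans (one_le_log_of_three_le hn)) (by linarith)
  have h4 := h.trans (Real.exp_le_exp.mpr h3)
  rw [Real.exp_log hn0] at h4
  exact_mod_cast h4

theorem three_le_truncLevel {n : ℕ} (hn : 3 ≤ n) (hL : 4 ≤ LL n) : 3 ≤ truncLevel n := by
  refine Nat.le_floor ?_
  have := Real.add_one_le_exp (Real.log n / (2 * ⌈LL n⌉₊))
  push_cast
  linarith [two_le_log_div hn hL]

theorem truncLevel_pow_le {n : ℕ} (hn : 3 ≤ n) (hL : 4 ≤ LL n) :
    (truncLevel n : ℝ) ^ ⌈LL n⌉₊ ≤ Real.sqrt n := by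
  have hn0 : (0 : ℝ) < n := by positivity
  have h2 : (0 : ℝ) < ⌈LL n⌉₊ := lt_of_lt_of_le (by linarith) (Nat.le_ceil (LL n))
  refine (pow_le_pow_left₀ (Nat.cast_nonneg _) (truncLevel_le_exp n) _).trans_eq ?_
  rw [← Real.exp_nat_mul, Real.sqrt_eq_rpow, Real.rpow_def_of_pos hn0]
  congr 1
  field_simp

theorem LL_mono {a b : ℕ} (ha : 3 ≤ a) (hab : a ≤ b) : LL a ≤ LL b := by
  have h1 := one_le_log_of_three_le ha
  have h3 : Real.log a ≤ Real.log b :=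
    Real.log_le_log (by positivity) (by exact_mod_cast hab)
  exact Real.log_le_log (by linarith) h3

theorem abs_LL_truncLevel_sub_le {n : ℕ} (hn : 3 ≤ n) (hL : 4 ≤ LL n) :
    |LL (truncLevel n) - LL n| ≤ Real.log (4 * (LL n + 1)) := by
  have hy := three_le_truncLevel hn hL
  rw [abs_sub_comm, abs_of_nonneg (by linarith [LL_mono hy (truncLevel_le hn hL)])]
  set E := Real.log n / (2 * ⌈LL n⌉₊) with hE
  have hE2 : 2 ≤ E := two_le_log_div hn hL
  have h1 : (⌈LL n⌉₊ : ℝ) < LL n + 1 := Nat.ceil_lt_add_one (by linarith)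
  have h2 : (0 : ℝ) < ⌈LL n⌉₊ := lt_of_lt_of_le (by linarith) (Nat.le_ceil (LL n))
  have h3 : Real.exp (E / 2) ≤ truncLevel n := by
    have h4 : Real.exp E - 1 < truncLevel n := Nat.sub_one_lt_floor _
    have h5 : Real.exp E = Real.exp (E / 2) * Real.exp (E / 2) := by
      rw [← Real.exp_add]; congr 1; ring
    have h6 := Real.add_one_le_exp (E / 2)
    nlinarith
  have h7 : E / 2 ≤ Real.log (truncLevel n) :=
    (Real.le_log_iff_exp_le (by positivity)).mpr h3
  have h8 : Real.log (E / 2) ≤ LL (truncLevel n) := Real.log_le_log (by positivity) h7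
  have h9 : Real.log (E / 2) = LL n - Real.log (4 * ⌈LL n⌉₊) := by
    have h10 : E / 2 = Real.log n / (4 * ⌈LL n⌉₊) := by rw [hE]; field_simp; norm_num
    rw [h10, Real.log_div (by linarith [one_le_log_of_three_le hn]) (by positivity)]
    rfl
  have h11 : Real.log (4 * ⌈LL n⌉₊) ≤ Real.log (4 * (LL n + 1)) :=
    Real.log_le_log (by positivity) (by linarith)
  linarith

theorem tendsto_log_LL_div_sqrt (C : ℝ) :
    Tendsto (fun n ↦ (C + Real.log (4 * (LL n + 1))) / Real.sqrt (LL n)) atTop (nhds 0) := by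
  have h1 : Tendsto (fun n ↦ (C + Real.log 8) / Real.sqrt (LL n)
      + Real.log (LL n) / (LL n) ^ (1 / 2 : ℝ)) atTop (nhds 0) := by
    have h2 := (Real.tendsto_sqrt_atTop.comp tendsto_LL_atTop).const_div_atTop (C + Real.log 8)
    have h3 := ((isLittleO_log_rpow_atTop (r := 1 / 2) (by norm_num)).tendsto_div_nhds_zero).comp
      tendsto_LL_atTop
    simpa using h2.add h3
  have h4 : Tendsto (fun n ↦ C / Real.sqrt (LL n)) atTop (nhds 0) :=
    (Real.tendsto_sqrt_atTop.comp tendsto_LL_atTop).const_div_atTop C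
  refine tendsto_of_tendsto_of_tendsto_of_le_of_le' h4 h1 ?_ ?_
  · filter_upwards [tendsto_LL_atTop.eventually_ge_atTop 1] with n hn
    gcongr
    linarith [Real.log_nonneg (show 1 ≤ 4 * (LL n + 1) by linarith)]
  · filter_upwards [tendsto_LL_atTop.eventually_ge_atTop 1] with n hn
    rw [← Real.sqrt_eq_rpow, ← add_div]
    refine div_le_div_of_nonneg_right ?_ (Real.sqrt_nonneg _)
    rw [add_assoc, ← Real.log_mul (by norm_num) (by linarith)]
    have := Real.log_le_log (by linarith) (show 4 * (LL n + 1) ≤ 8 * LL n by linarith)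
    linarith

theorem eventually_three_le_and_four_le_LL : ∀ᶠ n in atTop, 3 ≤ n ∧ 4 ≤ LL n :=
  (eventually_ge_atTop 3).and (tendsto_LL_atTop.eventually_ge_atTop 4)

theorem exists_abs_recipSum_truncLevel_sub_le (q : ℕ) [NeZero q] :
    ∃ C, ∀ n, 3 ≤ n → 4 ≤ LL n →
      |recipSum q (truncLevel n) - (q.totient : ℝ)⁻¹ * LL n| ≤ C + Real.log (4 * (LL n + 1)) := by
  obtain ⟨C, hC⟩ := abs_recipSum_sub_le q
  refine ⟨C, fun n hn hL ↦ ?_⟩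
  have h1 := hC _ (three_le_truncLevel hn hL)
  have h2 := abs_LL_truncLevel_sub_le hn hL
  have h3 : (q.totient : ℝ)⁻¹ ≤ 1 :=
    inv_le_one_of_one_le₀ (by exact_mod_cast Nat.totient_pos.mpr (NeZero.pos q))
  have h4 : 0 ≤ (q.totient : ℝ)⁻¹ := by positivity
  calc _ = |(recipSum q (truncLevel n) - (q.totient : ℝ)⁻¹ * LL (truncLevel n))
        + (q.totient : ℝ)⁻¹ * (LL (truncLevel n) - LL n)| := by congr 1; ring
    _ ≤ C + 1 * Real.log (4 * (LL n + 1)) := by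
        refine (abs_add_le _ _).trans (add_le_add h1 ?_)
        rw [abs_mul, abs_of_nonneg h4]
        exact mul_le_mul h3 h2 (abs_nonneg _) zero_le_one
    _ = _ := by rw [one_mul]

theorem tendsto_recipSum_truncLevel_sub_div_sqrt (q : ℕ) [NeZero q] :
    Tendsto (fun n ↦ (recipSum q (truncLevel n) - (q.totient : ℝ)⁻¹ * LL n) / Real.sqrt (LL n))
      atTop (nhds 0) := by
  obtain ⟨C, hC⟩ := exists_abs_recipSum_truncLevel_sub_le q
  refine squeeze_zero_norm' ?_ (tendsto_log_LL_div_sqrt C)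
  filter_upwards [eventually_three_le_and_four_le_LL] with n ⟨hn, hL⟩
  rw [norm_div, Real.norm_of_nonneg (Real.sqrt_nonneg _)]
  gcongr
  exact hC n hn hL

theorem tendsto_recipSum_truncLevel_div (q : ℕ) [NeZero q] :
    Tendsto (fun n ↦ recipSum q (truncLevel n) / LL n) atTop (nhds (q.totient : ℝ)⁻¹) := by
  have h1 := (tendsto_recipSum_truncLevel_sub_div_sqrt q).mul
    ((Real.tendsto_sqrt_atTop.comp tendsto_LL_atTop).const_div_atTop 1)
  have h2 := h1.const_add (q.totient : ℝ)⁻¹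
  rw [mul_zero, add_zero] at h2
  refine h2.congr' ?_
  filter_upwards [tendsto_LL_atTop.eventually_ge_atTop 1] with n hn
  have h3 : 0 < Real.sqrt (LL n) := Real.sqrt_pos.mpr (by linarith)
  have h4 : Real.sqrt (LL n) * Real.sqrt (LL n) = LL n := Real.mul_self_sqrt (by linarith)
  simp only [Function.comp]
  rw [div_mul_div_comm, mul_one, h4]
  field_simp
  ring

theorem primesOne_subset {q a b : ℕ} (h : a ≤ b) : primesOne q a ⊆ primesOne q b := fun p hp ↦ by
  rw [mem_primesOne] at hp ⊢
  exact ⟨hp.1.trans h, hp.2⟩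

theorem divCount_sdiff {S T : Finset ℕ} (h : S ⊆ T) (m : ℕ) :
    divCount T m = divCount S m + divCount (T \ S) m := by
  rw [divCount, divCount, divCount, ← Finset.card_union_of_disjoint, ← Finset.filter_union,
    Finset.union_sdiff_of_subset h]
  exact Finset.disjoint_filter_filter Finset.disjoint_sdiff

theorem divCount_truncLevel_le {q m n : ℕ} (hn : 3 ≤ n) (hL : 4 ≤ LL n) (hm : 1 ≤ m)
    (hmn : m ≤ n) : divCount (primesOne q (truncLevel n)) m ≤ omegaQ m q := by
  rw [omegaQ_eq_divCount hm hmn, divCount_sdiff (primesOne_subset (truncLevel_le hn hL))]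
  exact Nat.le_add_right _ _

/-- Few integers have many prime divisors beyond the sieving level. -/
theorem negDens_omegaQ_sub_divCount (q : ℕ) [NeZero q] {η : ℝ} (hη : 0 < η) :
    NegDens fun n m ↦
      η * Real.sqrt (LL n) ≤ omegaQ m q - divCount (primesOne q (truncLevel n)) m := by
  obtain ⟨C, hC⟩ := exists_abs_recipSum_truncLevel_sub_le q
  obtain ⟨C', hC'⟩ := abs_recipSum_sub_le q
  have h0 := (tendsto_log_LL_div_sqrt (C + C')).div_const η
  rw [zero_div] at h0
  refine NegDens.of_le h0 ?_
  filter_upwards [eventually_three_le_and_four_le_LL] with n ⟨hn, hL⟩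
  have hn0 : (0 : ℝ) < n := by positivity
  have hs : 0 < Real.sqrt (LL n) := Real.sqrt_pos.mpr (by linarith)
  have hsub := primesOne_subset (q := q) (truncLevel_le hn hL)
  set T := primesOne q n \ primesOne q (truncLevel n) with hT
  have h1 : cnt (fun m ↦ η * Real.sqrt (LL n) ≤
      (omegaQ m q : ℝ) - divCount (primesOne q (truncLevel n)) m) n
      ≤ cnt (fun m ↦ η * Real.sqrt (LL n) ≤ (divCount T m : ℝ)) n := by
    refine cnt_mono fun m hm hmn h ↦ ?_
    rw [omegaQ_eq_divCount hm hmn, divCount_sdiff hsub] at h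
    push_cast at h
    linarith
  have h2 := cnt_le_sum_div (f := fun m ↦ (divCount T m : ℝ)) (mul_pos hη hs) (n := n)
    fun m _ ↦ Nat.cast_nonneg _
  have h3 := sum_divCount_le T n
  have h4 : ∑ p ∈ T, (1 / p : ℝ) ≤ C + C' + Real.log (4 * (LL n + 1)) := by
    have h5 : ∑ p ∈ T, (1 / p : ℝ) = recipSum q n - recipSum q (truncLevel n) :=
      Finset.sum_sdiff_eq_sub hsub
    have h6 := (abs_le.mp (hC n hn hL)).1
    have h7 := (abs_le.mp (hC' n hn)).2
    linarith
  rw [div_le_iff₀ hn0]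
  calc _ ≤ _ := Nat.cast_le.mpr h1
    _ ≤ _ := h2
    _ ≤ (n * (C + C' + Real.log (4 * (LL n + 1)))) / (η * Real.sqrt (LL n)) := by
        gcongr
        exact h3.trans (by gcongr)
    _ = _ := by field_simp

theorem norm_prod_sub_prod_le_sum {ι : Type*} (S : Finset ι) {a b : ι → ℂ}
    (ha : ∀ i ∈ S, ‖a i‖ ≤ 1) (hb : ∀ i ∈ S, ‖b i‖ ≤ 1) :
    ‖∏ i ∈ S, a i - ∏ i ∈ S, b i‖ ≤ ∑ i ∈ S, ‖a i - b i‖ := by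
  classical
  induction S using Finset.induction_on with
  | empty => simp
  | insert i S hi ih =>
    rw [Finset.prod_insert hi, Finset.prod_insert hi, Finset.sum_insert hi]
    have h1 := ih (fun j hj ↦ ha j (Finset.mem_insert_of_mem hj))
      (fun j hj ↦ hb j (Finset.mem_insert_of_mem hj))
    have h2 : ‖∏ j ∈ S, b j‖ ≤ 1 := by
      rw [norm_prod]
      exact Finset.prod_le_one (fun _ _ ↦ norm_nonneg _)
        fun j hj ↦ hb j (Finset.mem_insert_of_mem hj)
    have h3 := ha i (Finset.mem_insert_self i S)
    calc _ = ‖a i * (∏ j ∈ S, a j - ∏ j ∈ S, b j) + (a i - b i) * ∏ j ∈ S, b j‖ := by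
          congr 1; ring
      _ ≤ 1 * ‖∏ j ∈ S, a j - ∏ j ∈ S, b j‖ + ‖a i - b i‖ * 1 := by
          refine (norm_add_le _ _).trans (add_le_add ?_ ?_) <;> rw [norm_mul] <;> gcongr
      _ ≤ _ := by linarith

theorem norm_one_add_cexp_sub_one_div_le {θ p : ℝ} (hp : 1 ≤ p) :
    ‖1 + (Complex.exp (θ * Complex.I) - 1) / p‖ ≤ 1 := by
  have e : 1 + (Complex.exp (θ * Complex.I) - 1) / p
      = ((1 - 1 / p : ℝ) : ℂ) + Complex.exp (θ * Complex.I) * ((1 / p : ℝ) : ℂ) := by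
    push_cast; ring
  have h1 : 1 / p ≤ 1 := by rw [div_le_one (by linarith)]; exact hp
  have h2 : 0 ≤ 1 / p := by positivity
  rw [e]
  refine (norm_add_le _ _).trans ?_
  rw [norm_mul, Complex.norm_exp_ofReal_mul_I, Complex.norm_of_nonneg (by linarith),
    Complex.norm_of_nonneg h2]
  linarith

theorem norm_cexp_div_le {θ p : ℝ} (hp : 1 ≤ p) :
    ‖Complex.exp ((θ * Complex.I - θ ^ 2 / 2) / p)‖ ≤ 1 := by
  have e : ((θ * Complex.I - θ ^ 2 / 2) / p : ℂ)
      = ((-(θ ^ 2 / 2 / p) : ℝ) : ℂ) + ((θ / p : ℝ) : ℂ) * Complex.I := by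
    push_cast; ring
  rw [e, Complex.exp_add, norm_mul, Complex.norm_exp_ofReal_mul_I, mul_one, Complex.norm_exp,
    Complex.ofReal_re, Real.exp_le_one_iff]
  have : 0 ≤ θ ^ 2 / 2 / p := by positivity
  linarith

theorem norm_one_add_sub_cexp_le {θ δ p : ℝ} (hp : 1 ≤ p) (hθ : |θ| ≤ δ) (hδ : δ ≤ 1 / 2) :
    ‖1 + (Complex.exp (θ * Complex.I) - 1) / p - Complex.exp ((θ * Complex.I - θ ^ 2 / 2) / p)‖
      ≤ δ ^ 3 * (1 / p) + 4 * δ ^ 2 * (1 / p ^ 2) := by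
  have hδ0 : 0 ≤ δ := (abs_nonneg _).trans hθ
  have hn : ‖(θ * Complex.I : ℂ)‖ = |θ| := by simp
  set u : ℂ := θ * Complex.I - θ ^ 2 / 2 with hu
  have hp0 : 0 < p := by linarith
  have h1 : ‖Complex.exp (θ * Complex.I) - 1 - u‖ ≤ δ ^ 3 := by
    have h := Complex.exp_bound (x := θ * Complex.I) (by rw [hn]; linarith) (n := 3) (by norm_num)
    have e : Complex.exp (θ * Complex.I) - ∑ m ∈ Finset.range 3, (θ * Complex.I : ℂ) ^ m / m.factorial
        = Complex.exp (θ * Complex.I) - 1 - u := by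
      simp only [Finset.sum_range_succ, Finset.sum_range_zero, Nat.factorial, hu, mul_pow,
        Complex.I_sq]
      push_cast
      ring
    rw [e, hn] at h
    refine h.trans ?_
    have h3 : |θ| ^ 3 ≤ δ ^ 3 := by gcongr
    have h4 : 0 ≤ |θ| ^ 3 := by positivity
    norm_num [Nat.factorial]
    linarith
  have h2 : ‖u‖ ≤ 2 * δ := by
    refine (norm_sub_le _ _).trans ?_
    rw [hn]
    have : ‖(θ ^ 2 / 2 : ℂ)‖ = |θ| * |θ| / 2 := by
      simp [sq]
    rw [this]
    nlinarith [abs_nonneg θ]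
  have h5 : ‖u / p‖ ≤ 2 * δ * (1 / p) := by
    rw [norm_div, Complex.norm_of_nonneg hp0.le, ← mul_one_div]
    gcongr
  have hp1 : 1 / p ≤ 1 := by rw [div_le_one hp0]; exact hp
  have h6 : ‖Complex.exp (u / p) - 1 - u / p‖ ≤ 4 * δ ^ 2 * (1 / p ^ 2) := by
    refine (Complex.norm_exp_sub_one_sub_id_le (h5.trans ?_)).trans ?_
    · nlinarith [show 0 ≤ 1 / p by positivity]
    · calc _ ≤ (2 * δ * (1 / p)) ^ 2 := by gcongr
        _ = _ := by ring
  calc _ = ‖(Complex.exp (θ * Complex.I) - 1 - u) * ((1 / p : ℝ) : ℂ)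
        - (Complex.exp (u / p) - 1 - u / p)‖ := by
        congr 1; push_cast; ring
    _ ≤ _ := by
        refine (norm_sub_le _ _).trans (add_le_add ?_ h6)
        rw [norm_mul, Complex.norm_of_nonneg (by positivity)]
        gcongr

/-- The coefficient of a prime `p` in a linear combination of the functions `omegaQ · q`. -/
def coeffAt (Q : Finset ℕ) (s : ℕ → ℝ) (p : ℕ) : ℝ :=
  ∑ q ∈ Q, s q * if p % q = 1 % q then 1 else 0

theorem primesOne_eq_filter (q y : ℕ) :
    primesOne q y = (primesOne 1 y).filter fun p ↦ p % q = 1 % q := by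
  ext p
  simp only [mem_primesOne, Finset.mem_filter, Nat.mod_one]
  tauto

theorem abs_coeffAt_le (Q : Finset ℕ) (s : ℕ → ℝ) (p : ℕ) : |coeffAt Q s p| ≤ ∑ q ∈ Q, |s q| := by
  refine (Finset.abs_sum_le_sum_abs _ _).trans (Finset.sum_le_sum fun q _ ↦ ?_)
  split_ifs <;> simp

theorem sum_mul_divCount (Q : Finset ℕ) (s : ℕ → ℝ) (y m : ℕ) :
    ∑ q ∈ Q, s q * (divCount (primesOne q y) m : ℝ)
      = ∑ p ∈ (primesOne 1 y).filter (· ∣ m), coeffAt Q s p := by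
  simp_rw [coeffAt]
  rw [Finset.sum_comm]
  refine Finset.sum_congr rfl fun q _ ↦ ?_
  rw [← Finset.mul_sum, divCount, primesOne_eq_filter, Finset.filter_filter, Finset.card_filter,
    Finset.sum_filter]
  push_cast
  congr 1
  refine Finset.sum_congr rfl fun p _ ↦ ?_
  by_cases h1 : p % q = 1 % q <;> by_cases h2 : p ∣ m <;> simp [h1, h2]

theorem recipSum_eq_sum_ite (q y : ℕ) :
    recipSum q y = ∑ p ∈ primesOne 1 y, (if p % q = 1 % q then 1 else 0) * (1 / p : ℝ) := by
  rw [recipSum, primesOne_eq_filter, Finset.sum_filter]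
  simp_rw [ite_mul, one_mul, zero_mul]

theorem sum_coeffAt_div (Q : Finset ℕ) (s : ℕ → ℝ) (y : ℕ) :
    ∑ p ∈ primesOne 1 y, coeffAt Q s p * (1 / p : ℝ) = ∑ q ∈ Q, s q * recipSum q y := by
  simp_rw [coeffAt, Finset.sum_mul, recipSum_eq_sum_ite]
  rw [Finset.sum_comm]
  refine Finset.sum_congr rfl fun q _ ↦ ?_
  rw [Finset.mul_sum]
  exact Finset.sum_congr rfl fun p _ ↦ by ring

theorem mod_eq_one_mod_and_iff (p q r : ℕ) :
    (p % q = 1 % q ∧ p % r = 1 % r) ↔ p % Nat.lcm q r = 1 % Nat.lcm q r := by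
  constructor
  · rintro ⟨h1, h2⟩
    exact Nat.modEq_iff_dvd.mpr (Int.coe_lcm_dvd (Nat.modEq_iff_dvd.mp h1) (Nat.modEq_iff_dvd.mp h2))
  · intro h
    exact ⟨Nat.ModEq.of_dvd (Nat.dvd_lcm_left q r) h, Nat.ModEq.of_dvd (Nat.dvd_lcm_right q r) h⟩

theorem sum_coeffAt_sq_div (Q : Finset ℕ) (s : ℕ → ℝ) (y : ℕ) :
    ∑ p ∈ primesOne 1 y, coeffAt Q s p ^ 2 * (1 / p : ℝ)
      = ∑ q ∈ Q, ∑ r ∈ Q, s q * s r * recipSum (Nat.lcm q r) y := by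
  simp_rw [coeffAt, sq, Finset.sum_mul_sum, Finset.sum_mul, recipSum_eq_sum_ite]
  rw [Finset.sum_comm]
  refine Finset.sum_congr rfl fun q _ ↦ ?_
  rw [Finset.sum_comm]
  refine Finset.sum_congr rfl fun r _ ↦ ?_
  rw [Finset.mul_sum]
  refine Finset.sum_congr rfl fun p _ ↦ ?_
  have := mod_eq_one_mod_and_iff p q r
  by_cases h1 : p % q = 1 % q <;> by_cases h2 : p % r = 1 % r <;>
    simp only [h1, h2, and_self, and_true, and_false, true_iff, false_iff] at this <;>
    simp [h1, h2, this]

theorem card_primesOne_add_one_le (q : ℕ) {y : ℕ} (hy : 1 ≤ y) : (primesOne q y).card + 1 ≤ y := by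
  have : primesOne q y ⊆ Finset.Icc 2 y := fun p hp ↦ by
    have := mem_primesOne.mp hp
    exact Finset.mem_Icc.mpr ⟨this.2.1.two_le, this.1⟩
  have h := Finset.card_le_card this
  rw [Nat.card_Icc] at h
  omega

/-- The linear statistic whose limit law is computed below. -/
def linStat (Q : Finset ℕ) (s : ℕ → ℝ) (n m : ℕ) : ℝ :=
  (∑ q ∈ Q, s q * (divCount (primesOne q (truncLevel n)) m - (q.totient : ℝ)⁻¹ * LL n))
    / Real.sqrt (LL n)

theorem cexp_linStat (Q : Finset ℕ) (s : ℕ → ℝ) (n m : ℕ) :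
    Complex.exp (linStat Q s n m * Complex.I)
      = Complex.exp (((-(∑ q ∈ Q, s q * ((q.totient : ℝ)⁻¹ * LL n)) / Real.sqrt (LL n) : ℝ) : ℂ)
          * Complex.I)
        * ∏ p ∈ (primesOne 1 (truncLevel n)).filter (· ∣ m),
          (1 + (Complex.exp (((coeffAt Q s p / Real.sqrt (LL n) : ℝ) : ℂ) * Complex.I) - 1)) := by
  simp_rw [add_sub_cancel]
  rw [← Complex.exp_sum, ← Complex.exp_add, ← Finset.sum_mul, ← add_mul, ← Complex.ofReal_sum,
    ← Complex.ofReal_add, ← Finset.sum_div, ← sum_mul_divCount, linStat]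
  congr 3
  simp_rw [mul_sub, Finset.sum_sub_distrib]
  ring

/-- The characteristic function of the main part of the limit law. -/
def mainChar (Q : Finset ℕ) (s : ℕ → ℝ) (n : ℕ) : ℂ :=
  Complex.exp (((-(∑ q ∈ Q, s q * ((q.totient : ℝ)⁻¹ * LL n)) / Real.sqrt (LL n) : ℝ) : ℂ)
      * Complex.I)
    * ∏ p ∈ primesOne 1 (truncLevel n),
      Complex.exp ((((coeffAt Q s p / Real.sqrt (LL n) : ℝ) : ℂ) * Complex.I
        - ((coeffAt Q s p / Real.sqrt (LL n) : ℝ) : ℂ) ^ 2 / 2) / ((p : ℝ) : ℂ))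

theorem tendsto_mainChar {Q : Finset ℕ} (hQ : ∀ q ∈ Q, q ≠ 0) (s : ℕ → ℝ) :
    Tendsto (mainChar Q s) atTop (nhds (Complex.exp
      ((-(1 / 2) * ∑ q ∈ Q, ∑ r ∈ Q, s q * s r * ((Nat.lcm q r).totient : ℝ)⁻¹ : ℝ) : ℂ))) := by
  have h1 : Tendsto (fun n ↦ ∑ q ∈ Q, s q *
      ((recipSum q (truncLevel n) - (q.totient : ℝ)⁻¹ * LL n) / Real.sqrt (LL n))) atTop
      (nhds 0) := by
    have : (0 : ℝ) = ∑ q ∈ Q, s q * 0 := by simp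
    rw [this]
    refine tendsto_finsetSum _ fun q hq ↦ ?_
    have : NeZero q := ⟨hQ q hq⟩
    exact (tendsto_recipSum_truncLevel_sub_div_sqrt q).const_mul _
  have h2 : Tendsto (fun n ↦ -(1 / 2) * ∑ q ∈ Q, ∑ r ∈ Q, s q * s r *
      (recipSum (Nat.lcm q r) (truncLevel n) / LL n)) atTop
      (nhds (-(1 / 2) * ∑ q ∈ Q, ∑ r ∈ Q, s q * s r * ((Nat.lcm q r).totient : ℝ)⁻¹)) := by
    refine (tendsto_finsetSum _ fun q hq ↦ tendsto_finsetSum _ fun r hr ↦ ?_).const_mul _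
    have : NeZero (Nat.lcm q r) := ⟨Nat.lcm_ne_zero (hQ q hq) (hQ r hr)⟩
    exact (tendsto_recipSum_truncLevel_div _).const_mul _
  have h3 := ((Complex.continuous_ofReal.tendsto _).comp h1).mul_const Complex.I
  have h4 := h3.add ((Complex.continuous_ofReal.tendsto _).comp h2)
  simp only [Complex.ofReal_zero, zero_mul, zero_add] at h4
  refine ((Complex.continuous_exp.tendsto _).comp h4).congr' ?_
  filter_upwards [tendsto_LL_atTop.eventually_ge_atTop 1] with n hn
  have hr : 0 < Real.sqrt (LL n) := Real.sqrt_pos.mpr (by linarith)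
  have hr2 : Real.sqrt (LL n) ^ 2 = LL n := Real.sq_sqrt (by linarith)
  simp only [Function.comp, mainChar]
  rw [← Complex.exp_sum, ← Complex.exp_add]
  congr 1
  have e1 : ∑ p ∈ primesOne 1 (truncLevel n),
      ((((coeffAt Q s p / Real.sqrt (LL n) : ℝ) : ℂ) * Complex.I
        - ((coeffAt Q s p / Real.sqrt (LL n) : ℝ) : ℂ) ^ 2 / 2) / ((p : ℝ) : ℂ))
      = (((∑ p ∈ primesOne 1 (truncLevel n), coeffAt Q s p * (1 / p : ℝ)) / Real.sqrt (LL n) : ℝ) : ℂ)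
          * Complex.I
        + ((-(1 / 2) * ((∑ p ∈ primesOne 1 (truncLevel n), coeffAt Q s p ^ 2 * (1 / p : ℝ))
          / LL n) : ℝ) : ℂ) := by
    rw [Finset.sum_div, Finset.sum_div, Finset.mul_sum, Complex.ofReal_sum, Complex.ofReal_sum,
      Finset.sum_mul, ← Finset.sum_add_distrib]
    refine Finset.sum_congr rfl fun p _ ↦ ?_
    have hC : ((LL n : ℝ) : ℂ) = (Real.sqrt (LL n) : ℂ) ^ 2 := by rw [← Complex.ofReal_pow, hr2]
    push_cast
    rw [hC]
    ring
  rw [e1, sum_coeffAt_div, sum_coeffAt_sq_div, ← add_assoc, ← add_mul, ← Complex.ofReal_add]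
  congr 3
  · rw [← add_div, ← sub_eq_neg_add, ← Finset.sum_sub_distrib, Finset.sum_div]
    refine Finset.sum_congr rfl fun q _ ↦ ?_
    ring
  · simp_rw [Finset.sum_div, mul_div_assoc]

theorem norm_average_cexp_linStat_sub_mainChar_le (Q : Finset ℕ) (s : ℕ → ℝ) {n : ℕ} (hn : 3 ≤ n)
    (hL : 4 ≤ LL n) (hR : recipSum 1 (truncLevel n) ≤ 2 * LL n)
    (hB : 8 * ∑ q ∈ Q, |s q| + 2 ≤ Real.sqrt (LL n)) :
    ‖(∑ m ∈ Finset.Icc 1 n, Complex.exp (linStat Q s n m * Complex.I)) / n - mainChar Q s n‖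
      ≤ 1 / Real.sqrt n + Real.exp (-Real.sqrt (LL n))
        + 2 * (∑ q ∈ Q, |s q|) ^ 3 / Real.sqrt (LL n)
        + 4 * (∑ q ∈ Q, |s q|) ^ 2 * (∑' k : ℕ, 1 / (k : ℝ) ^ 2) / LL n := by
  set B := ∑ q ∈ Q, |s q| with hBdef
  set r := Real.sqrt (LL n) with hr
  have hr0 : 0 < r := Real.sqrt_pos.mpr (by linarith)
  have hr2 : r ^ 2 = LL n := Real.sq_sqrt (by linarith)
  have hn0 : (0 : ℝ) < n := by positivity
  have hB0 : 0 ≤ B := Finset.sum_nonneg fun _ _ ↦ abs_nonneg _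
  set S := primesOne 1 (truncLevel n) with hS
  set δ := B / r with hδ
  have hδ0 : 0 ≤ δ := by positivity
  have hδ1 : δ ≤ 1 / 2 := by rw [hδ, div_le_iff₀ hr0]; linarith
  have hθ : ∀ p, |coeffAt Q s p / r| ≤ δ := fun p ↦ by
    rw [abs_div, abs_of_pos hr0]
    exact div_le_div_of_nonneg_right (abs_coeffAt_le Q s p) hr0.le
  set w : ℕ → ℂ := fun p ↦ Complex.exp (((coeffAt Q s p / r : ℝ) : ℂ) * Complex.I) - 1 with hw
  have hwδ : ∀ p ∈ S, ‖w p‖ ≤ δ := fun p _ ↦ by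
    have := Real.norm_exp_I_mul_ofReal_sub_one_le (x := coeffAt Q s p / r)
    rw [mul_comm] at this
    exact this.trans (hθ p)
  have hprime : ∀ p ∈ S, (1 : ℝ) ≤ p := fun p hp ↦ by
    exact_mod_cast (prime_of_mem_primesOne hp).one_le
  have hF := norm_average_prod_sub_prod_le (S := S) (fun p hp ↦ prime_of_mem_primesOne hp) hδ0
    (by linarith) hwδ ⌈LL n⌉₊ (by omega : 0 < n)
  have hP : ‖∏ p ∈ S, (1 + w p / p) - ∏ p ∈ S, Complex.exp ((((coeffAt Q s p / r : ℝ) : ℂ)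
      * Complex.I - ((coeffAt Q s p / r : ℝ) : ℂ) ^ 2 / 2) / ((p : ℝ) : ℂ))‖
      ≤ ∑ p ∈ S, (δ ^ 3 * (1 / p : ℝ) + 4 * δ ^ 2 * (1 / (p : ℝ) ^ 2)) := by
    refine (norm_prod_sub_prod_le_sum S (fun p hp ↦ ?_) fun p hp ↦ ?_).trans
      (Finset.sum_le_sum fun p hp ↦ ?_)
    · exact_mod_cast norm_one_add_cexp_sub_one_div_le (hprime p hp)
    · exact norm_cexp_div_le (hprime p hp)
    · exact norm_one_add_sub_cexp_le (hprime p hp) (hθ p) hδ1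
  set E := Complex.exp (((-(∑ q ∈ Q, s q * ((q.totient : ℝ)⁻¹ * LL n)) / r : ℝ) : ℂ)
      * Complex.I) with hE
  have hE1 : ‖E‖ = 1 := Complex.norm_exp_ofReal_mul_I _
  have hkey : ‖(∑ m ∈ Finset.Icc 1 n, Complex.exp (linStat Q s n m * Complex.I)) / n
      - mainChar Q s n‖ ≤ ((S.card + 1 : ℝ) ^ ⌈LL n⌉₊ / n + (1 / 2) ^ ⌈LL n⌉₊ *
        Real.exp (2 * δ * ∑ p ∈ S, (1 / p : ℝ)))
        + ∑ p ∈ S, (δ ^ 3 * (1 / p : ℝ) + 4 * δ ^ 2 * (1 / (p : ℝ) ^ 2)) := by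
    simp_rw [cexp_linStat]
    rw [← Finset.mul_sum, mainChar, mul_div_assoc, ← mul_sub, norm_mul, hE1, one_mul]
    rw [← sub_add_sub_cancel _ (∏ p ∈ S, (1 + w p / p))]
    exact (norm_add_le _ _).trans (add_le_add hF hP)
  have t1 : (S.card + 1 : ℝ) ^ ⌈LL n⌉₊ / n ≤ 1 / Real.sqrt n := by
    have h1 : (S.card + 1 : ℝ) ≤ truncLevel n := by
      exact_mod_cast card_primesOne_add_one_le 1 (by linarith [three_le_truncLevel hn hL])
    calc _ ≤ (truncLevel n : ℝ) ^ ⌈LL n⌉₊ / n := by gcongr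
      _ ≤ Real.sqrt n / n := by gcongr; exact truncLevel_pow_le hn hL
      _ = _ := Real.sqrt_div_self'
  have t2 : (1 / 2 : ℝ) ^ ⌈LL n⌉₊ * Real.exp (2 * δ * ∑ p ∈ S, (1 / p : ℝ)) ≤ Real.exp (-r) := by
    have h1 : (1 / 2 : ℝ) ≤ Real.exp (-(1 / 2)) := by
      linarith [Real.add_one_le_exp (-(1 / 2) : ℝ)]
    have h2 : (1 / 2 : ℝ) ^ ⌈LL n⌉₊ ≤ Real.exp (-(1 / 2) * LL n) := by
      calc _ ≤ (Real.exp (-(1 / 2))) ^ ⌈LL n⌉₊ := by gcongr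
        _ = Real.exp (-(1 / 2) * ⌈LL n⌉₊) := by rw [← Real.exp_nat_mul, mul_comm]
        _ ≤ _ := Real.exp_le_exp.mpr (by linarith [Nat.le_ceil (LL n)])
    have h3 : 2 * δ * ∑ p ∈ S, (1 / p : ℝ) ≤ 4 * B * r := by
      calc _ ≤ 2 * δ * (2 * LL n) := by gcongr; exact hR
        _ = _ := by rw [← hr2, hδ]; field_simp; ring
    calc _ ≤ Real.exp (-(1 / 2) * LL n) * Real.exp (4 * B * r) := by gcongr
      _ = Real.exp (-(1 / 2) * r ^ 2 + 4 * B * r) := by rw [← Real.exp_add, hr2]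
      _ ≤ _ := Real.exp_le_exp.mpr (by nlinarith)
  have t3 : ∑ p ∈ S, (δ ^ 3 * (1 / p : ℝ) + 4 * δ ^ 2 * (1 / (p : ℝ) ^ 2))
      ≤ 2 * B ^ 3 / r + 4 * B ^ 2 * (∑' k : ℕ, 1 / (k : ℝ) ^ 2) / LL n := by
    rw [Finset.sum_add_distrib, ← Finset.mul_sum, ← Finset.mul_sum]
    have h1 : ∑ p ∈ S, (1 / (p : ℝ) ^ 2) ≤ ∑' k : ℕ, 1 / (k : ℝ) ^ 2 :=
      (Real.summable_one_div_nat_pow.mpr (by norm_num)).sum_le_tsum _ fun _ _ ↦ by positivity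
    calc _ ≤ δ ^ 3 * (2 * LL n) + 4 * δ ^ 2 * ∑' k : ℕ, 1 / (k : ℝ) ^ 2 := by
          gcongr
          exact hR
      _ = _ := by rw [hδ, ← hr2]; field_simp
  linarith

/-- The limiting characteristic function of linear combinations of `omegaQ · q`. -/
theorem tendsto_average_cexp_linStat {Q : Finset ℕ} (hQ : ∀ q ∈ Q, q ≠ 0) (s : ℕ → ℝ) :
    Tendsto (fun n : ℕ ↦ (∑ m ∈ Finset.Icc 1 n, Complex.exp (linStat Q s n m * Complex.I)) / n)
      atTop (nhds (Complex.exp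
        ((-(1 / 2) * ∑ q ∈ Q, ∑ r ∈ Q, s q * s r * ((Nat.lcm q r).totient : ℝ)⁻¹ : ℝ) : ℂ))) := by
  have hsq := Real.tendsto_sqrt_atTop.comp tendsto_LL_atTop
  have hu : Tendsto (fun n : ℕ ↦ 1 / Real.sqrt n + Real.exp (-Real.sqrt (LL n))
        + 2 * (∑ q ∈ Q, |s q|) ^ 3 / Real.sqrt (LL n)
        + 4 * (∑ q ∈ Q, |s q|) ^ 2 * (∑' k : ℕ, 1 / (k : ℝ) ^ 2) / LL n) atTop (nhds 0) := by
    have h1 := (Real.tendsto_sqrt_atTop.comp tendsto_natCast_atTop_atTop).const_div_atTop (1 : ℝ)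
    have h2 := Real.tendsto_exp_neg_atTop_nhds_zero.comp hsq
    have h3 := hsq.const_div_atTop (2 * (∑ q ∈ Q, |s q|) ^ 3)
    have h4 := tendsto_LL_atTop.const_div_atTop
      (4 * (∑ q ∈ Q, |s q|) ^ 2 * (∑' k : ℕ, 1 / (k : ℝ) ^ 2))
    simpa using ((h1.add h2).add h3).add h4
  have h5 : Tendsto (fun n : ℕ ↦ (∑ m ∈ Finset.Icc 1 n, Complex.exp (linStat Q s n m * Complex.I)) / n
      - mainChar Q s n) atTop (nhds 0) := by
    refine squeeze_zero_norm' ?_ hu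
    have h6 := (tendsto_recipSum_truncLevel_div 1).eventually_le_const
      (show ((1 : ℕ).totient : ℝ)⁻¹ < 2 by norm_num)
    filter_upwards [eventually_three_le_and_four_le_LL, h6,
      hsq.eventually_ge_atTop (8 * ∑ q ∈ Q, |s q| + 2)] with n ⟨hn, hL⟩ hR hB
    rw [div_le_iff₀ (by linarith)] at hR
    exact norm_average_cexp_linStat_sub_mainChar_le Q s hn hL hR hB
  simpa using h5.add (tendsto_mainChar hQ s)

/-- The law of `A z` for a standard Gaussian vector `z`. -/
def gaussianMap (A : Matrix (Fin 4) (Fin 4) ℝ) : Measure (EuclideanSpace ℝ (Fin 4)) :=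
  (_root_.stdGaussian 4).map fun z ↦ WithLp.toLp 2 (A.mulVec z)

instance (k : ℕ) : IsProbabilityMeasure (_root_.stdGaussian k) := by
  unfold _root_.stdGaussian; infer_instance

theorem measurable_toLp_mulVec (A : Matrix (Fin 4) (Fin 4) ℝ) :
    Measurable fun z : Fin 4 → ℝ ↦ (WithLp.toLp 2 (A.mulVec z) : EuclideanSpace ℝ (Fin 4)) :=
  (MeasurableEquiv.toLp 2 (Fin 4 → ℝ)).measurable.comp
    (Continuous.matrix_mulVec continuous_const continuous_id).measurable

instance (A : Matrix (Fin 4) (Fin 4) ℝ) : IsProbabilityMeasure (gaussianMap A) :=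
  Measure.isProbabilityMeasure_map (measurable_toLp_mulVec A).aemeasurable

theorem charFun_gaussianMap (A : Matrix (Fin 4) (Fin 4) ℝ) (t : EuclideanSpace ℝ (Fin 4)) :
    charFun (gaussianMap A) t
      = Complex.exp ((-(1 / 2) * ((t : Fin 4 → ℝ) ⬝ᵥ ((A * A.transpose).mulVec t)) : ℝ) : ℂ) := by
  have hm2 : Measurable (WithLp.toLp 2 : (Fin 4 → ℝ) → EuclideanSpace ℝ (Fin 4)) :=
    (MeasurableEquiv.toLp 2 (Fin 4 → ℝ)).measurable
  have h1 : charFun (gaussianMap A) t = charFun ((_root_.stdGaussian 4).map (WithLp.toLp 2))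
      (WithLp.toLp 2 (A.transpose.mulVec t)) := by
    rw [charFun_apply, charFun_apply, gaussianMap, integral_map (measurable_toLp_mulVec A).aemeasurable
      (by fun_prop), integral_map hm2.aemeasurable
      (by fun_prop)]
    refine integral_congr_ae (Eventually.of_forall fun z ↦ ?_)
    simp only [EuclideanSpace.inner_eq_star_dotProduct, star_trivial]
    rw [Matrix.dotProduct_mulVec, dotProduct_comm (A.transpose.mulVec _),
      Matrix.mulVec_transpose, dotProduct_comm]
  rw [h1, _root_.stdGaussian, charFun_pi]
  simp_rw [charFun_gaussianReal]
  rw [← Complex.exp_sum]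
  congr 1
  have h2 : (t : Fin 4 → ℝ) ⬝ᵥ ((A * A.transpose).mulVec t)
      = ∑ i, (A.transpose.mulVec t) i ^ 2 := by
    rw [← Matrix.mulVec_mulVec, Matrix.dotProduct_mulVec, ← Matrix.mulVec_transpose]
    simp [dotProduct, sq]
  rw [h2, Finset.mul_sum, Complex.ofReal_sum]
  refine Finset.sum_congr rfl fun i _ ↦ ?_
  push_cast
  ring

theorem gaussianMap_coord_eq_zero {A : Matrix (Fin 4) (Fin 4) ℝ} {j : Fin 4}
    (hj : 0 < (A * A.transpose) j j) (x : ℝ) : gaussianMap A {v | v j = x} = 0 := by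
  have hm : Measurable fun v : EuclideanSpace ℝ (Fin 4) ↦ v j := by fun_prop
  have h1 : (gaussianMap A).map (fun v ↦ v j) = gaussianReal 0 ((A * A.transpose) j j).toNNReal := by
    have : IsProbabilityMeasure ((gaussianMap A).map fun v ↦ v j) :=
      Measure.isProbabilityMeasure_map hm.aemeasurable
    refine Measure.ext_of_charFun (funext fun s ↦ ?_)
    have h2 : charFun ((gaussianMap A).map fun v ↦ v j) s
        = charFun (gaussianMap A) (EuclideanSpace.single j s) := by
      rw [charFun_apply, charFun_apply, integral_map hm.aemeasurable (by fun_prop)]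
      simp [EuclideanSpace.inner_single_right]
    rw [h2, charFun_gaussianMap, charFun_gaussianReal]
    congr 1
    simp [Real.coe_toNNReal _ hj.le]
    ring
  have h3 : gaussianMap A {v | v j = x} = (gaussianMap A).map (fun v ↦ v j) {x} := by
    rw [Measure.map_apply hm (measurableSet_singleton x)]
    rfl
  rw [h3, h1]
  have := nullSingletonClass_gaussianReal (μ := 0)
    (Real.toNNReal_pos.mpr hj).ne'
  exact measure_singleton x

/-- The smallest coordinate of a vector. -/
def minCoord (v : Fin 4 → ℝ) : ℝ := Finset.univ.inf' Finset.univ_nonempty v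

theorem continuous_minCoord : Continuous minCoord :=
  Continuous.finset_inf'_apply _ fun i _ ↦ continuous_apply i

theorem gaussianMap_minCoord_eq_zero {A : Matrix (Fin 4) (Fin 4) ℝ}
    (hA : ∀ j, 0 < (A * A.transpose) j j) (x : ℝ) :
    gaussianMap A {v | minCoord v = x} = 0 := by
  have h : {v : EuclideanSpace ℝ (Fin 4) | minCoord v = x} ⊆ ⋃ j, {v | v j = x} := by
    intro v hv
    obtain ⟨j, -, hj⟩ := Finset.exists_mem_eq_inf' (Finset.univ_nonempty (α := Fin 4)) (v : Fin 4 → ℝ)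
    exact Set.mem_iUnion.mpr ⟨j, hj.symm.trans hv⟩
  exact measure_mono_null h (measure_iUnion_null fun j ↦ gaussianMap_coord_eq_zero (hA j) x)

/-- The uniform measure on the values `V 1, …, V n`. -/
def empMeasure {E : Type*} [MeasurableSpace E] (n : ℕ) (V : ℕ → E) : Measure E :=
  (n : ENNReal)⁻¹ • ∑ m ∈ Finset.Icc 1 n, Measure.dirac (V m)

theorem empMeasure_apply {E : Type*} [MeasurableSpace E] (n : ℕ) (V : ℕ → E) {s : Set E}
    (hs : MeasurableSet s) : empMeasure n V s = (n : ENNReal)⁻¹ * cnt (fun m ↦ V m ∈ s) n := by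
  classical
  rw [empMeasure, Measure.smul_apply, Measure.coe_finsetSum, Finset.sum_apply, cnt_eq_card,
    smul_eq_mul, Finset.card_filter]
  push_cast
  congr 1
  refine Finset.sum_congr rfl fun m _ ↦ ?_
  rw [Measure.dirac_apply' _ hs, Set.indicator_apply]
  congr

theorem toReal_empMeasure_apply {E : Type*} [MeasurableSpace E] (n : ℕ) (V : ℕ → E) {s : Set E}
    (hs : MeasurableSet s) : (empMeasure n V s).toReal = (cnt (fun m ↦ V m ∈ s) n : ℝ) / n := by
  rw [empMeasure_apply n V hs]
  simp [ENNReal.toReal_mul, inv_mul_eq_div]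

theorem isProbabilityMeasure_empMeasure {E : Type*} [MeasurableSpace E] {n : ℕ} (hn : 0 < n)
    (V : ℕ → E) : IsProbabilityMeasure (empMeasure n V) := by
  refine ⟨?_⟩
  rw [empMeasure_apply n V MeasurableSet.univ, cnt_eq_card]
  simp only [Set.mem_univ, Finset.filter_true, Nat.card_Icc, Nat.add_sub_cancel]
  exact ENNReal.inv_mul_cancel (by exact_mod_cast hn.ne') (ENNReal.natCast_ne_top n)

theorem charFun_empMeasure (n : ℕ) (V : ℕ → EuclideanSpace ℝ (Fin 4))
    (t : EuclideanSpace ℝ (Fin 4)) : charFun (empMeasure n V) t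
      = (∑ m ∈ Finset.Icc 1 n, Complex.exp ((inner ℝ (V m) t : ℝ) * Complex.I)) / n := by
  rw [charFun_apply, empMeasure, integral_smul_measure, integral_finsetSum_measure]
  · simp [inv_mul_eq_div]
  · intro m _
    exact integrable_dirac (by simp)

/-- The number of primes `p ≡ 1 (mod q)` dividing `m`, up to the truncation level. -/
def truncOmega (n m q : ℕ) : ℕ := divCount (primesOne q (truncLevel n)) m

/-- The four normalized differences whose minimum governs the count. -/
def diffVec (n m : ℕ) : EuclideanSpace ℝ (Fin 4) :=
  WithLp.toLp 2 fun i ↦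
    ((truncOmega n m (![3, 3, 4, 4] i) : ℝ) - truncOmega n m (![5, 8, 5, 8] i) - 1 / 4 * LL n)
      / √(1 / 2 * LL n)

/-- The coefficients expressing an inner product with `diffVec` as a linear statistic. -/
def linCoeff (t : Fin 4 → ℝ) (q : ℕ) : ℝ :=
  √2 * (if q = 3 then t 0 + t 1 else if q = 4 then t 2 + t 3
    else if q = 5 then -(t 0 + t 2) else -(t 1 + t 3))

theorem inner_diffVec {n : ℕ} (hn : 0 < LL n) (m : ℕ) (t : EuclideanSpace ℝ (Fin 4)) :
    inner ℝ (diffVec n m) t = linStat {3, 4, 5, 8} (linCoeff t) n m := by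
  have h2 : √(1 / 2 * LL n) = √(LL n) / √2 := by
    rw [← Real.sqrt_div hn.le]; congr 1; ring
  have hL : √(LL n) ≠ 0 := (Real.sqrt_pos.mpr hn).ne'
  have hs : √(2 : ℝ) ≠ 0 := by positivity
  have e3 : Nat.totient 3 = 2 := by decide
  have e4 : Nat.totient 4 = 2 := by decide
  have e5 : Nat.totient 5 = 4 := by decide
  have e8 : Nat.totient 8 = 4 := by decide
  simp only [EuclideanSpace.inner_eq_star_dotProduct, star_trivial, dotProduct, Fin.sum_univ_four,
    diffVec, h2, linStat, linCoeff, truncOmega]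
  simp [e3, e4, e5, e8]
  field_simp
  ring

/-- The covariance matrix of the four normalized differences. -/
def covMatrix : Matrix (Fin 4) (Fin 4) ℝ :=
  !![1, 5/8, 1/2, 1/8;
     5/8, 1, -1/8, 1/4;
     1/2, -1/8, 1, 3/8;
     1/8, 1/4, 3/8, 1/2]

theorem covMatrix_diag_pos (j : Fin 4) : 0 < covMatrix j j := by
  fin_cases j <;> norm_num [covMatrix]

theorem sum_linCoeff (t : Fin 4 → ℝ) :
    ∑ q ∈ ({3, 4, 5, 8} : Finset ℕ), ∑ r ∈ ({3, 4, 5, 8} : Finset ℕ),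
      linCoeff t q * linCoeff t r * ((Nat.lcm q r).totient : ℝ)⁻¹ = t ⬝ᵥ covMatrix.mulVec t := by
  have e3 : Nat.totient 3 = 2 := by decide
  have e4 : Nat.totient 4 = 2 := by decide
  have e5 : Nat.totient 5 = 4 := by decide
  have e8 : Nat.totient 8 = 4 := by decide
  have e12 : Nat.totient 12 = 4 := by decide
  have e15 : Nat.totient 15 = 8 := by decide
  have e20 : Nat.totient 20 = 8 := by decide
  have e24 : Nat.totient 24 = 8 := by decide
  have e40 : Nat.totient 40 = 16 := by decide
  have hs : √(2 : ℝ) ^ 2 = 2 := Real.sq_sqrt (by norm_num)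
  simp [linCoeff, dotProduct, Matrix.mulVec, Fin.sum_univ_four, covMatrix, Nat.lcm,
    e3, e4, e5, e8, e12, e15, e20, e24, e40]
  ring_nf
  rw [hs]
  ring

theorem tendsto_charFun_diffVec {A : Matrix (Fin 4) (Fin 4) ℝ} (hA : A * A.transpose = covMatrix)
    (t : EuclideanSpace ℝ (Fin 4)) :
    Tendsto (fun n ↦ charFun (empMeasure n (diffVec n)) t) atTop (nhds (charFun (gaussianMap A) t)) := by
  have h := tendsto_average_cexp_linStat (Q := {3, 4, 5, 8}) (by simp) (linCoeff t)
  rw [sum_linCoeff] at h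
  rw [charFun_gaussianMap, hA]
  refine h.congr' ?_
  filter_upwards [tendsto_LL_atTop.eventually_gt_atTop 0] with n hn
  rw [charFun_empMeasure]
  simp_rw [inner_diffVec hn]

theorem tendsto_cnt_minCoord_diffVec {A : Matrix (Fin 4) (Fin 4) ℝ}
    (hA : A * A.transpose = covMatrix) (x : ℝ) :
    Tendsto (fun n : ℕ ↦ (cnt (fun m ↦ minCoord (diffVec n m) ≤ x) n : ℝ) / n) atTop
      (nhds (gaussianMap A {v | minCoord v ≤ x}).toReal) := by
  have hc : Continuous fun v : EuclideanSpace ℝ (Fin 4) ↦ minCoord v :=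
    continuous_minCoord.comp (PiLp.continuous_ofLp 2 _)
  rw [← tendsto_add_atTop_iff_nat 1]
  let P : ℕ → ProbabilityMeasure (EuclideanSpace ℝ (Fin 4)) := fun n ↦
    ⟨empMeasure (n + 1) (diffVec (n + 1)), isProbabilityMeasure_empMeasure n.succ_pos _⟩
  let G : ProbabilityMeasure (EuclideanSpace ℝ (Fin 4)) := ⟨gaussianMap A, inferInstance⟩
  have hP : Tendsto P atTop (nhds G) := by
    refine ProbabilityMeasure.tendsto_of_tendsto_charFun fun t ↦ ?_
    exact (tendsto_add_atTop_iff_nat 1).mpr (tendsto_charFun_diffVec hA t)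
  have hs : IsClosed {v : EuclideanSpace ℝ (Fin 4) | minCoord v ≤ x} :=
    isClosed_le hc continuous_const
  have hf : (G : Measure (EuclideanSpace ℝ (Fin 4)))
      (frontier {v : EuclideanSpace ℝ (Fin 4) | minCoord v ≤ x}) = 0 :=
    measure_mono_null (frontier_le_subset_eq hc continuous_const)
      (gaussianMap_minCoord_eq_zero (by rw [hA]; exact covMatrix_diag_pos) x)
  have h := ProbabilityMeasure.tendsto_measure_of_null_frontier_of_tendsto' hP hf
  have h' := (ENNReal.tendsto_toReal (measure_ne_top _ _)).comp h
  refine h'.congr fun n ↦ ?_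
  exact toReal_empMeasure_apply _ _ hs.measurableSet

theorem continuous_cdf_of_measure_singleton {ν : Measure ℝ} [IsProbabilityMeasure ν]
    (h : ∀ x, ν {x} = 0) : Continuous (cdf ν) := by
  rw [continuous_iff_continuousAt]
  intro x
  rw [(monotone_cdf ν).continuousAt_iff_leftLim_eq_rightLim, StieltjesFunction.rightLim_eq]
  have h1 := h x
  rw [← measure_cdf ν, StieltjesFunction.measure_singleton, ENNReal.ofReal_eq_zero] at h1
  exact le_antisymm ((monotone_cdf ν).leftLim_le le_rfl) (by linarith)

theorem continuous_gaussianMap_minCoord {A : Matrix (Fin 4) (Fin 4) ℝ}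
    (hA : ∀ j, 0 < (A * A.transpose) j j) :
    Continuous fun x : ℝ ↦ (gaussianMap A {v | minCoord v ≤ x}).toReal := by
  have hm : Measurable fun v : EuclideanSpace ℝ (Fin 4) ↦ minCoord v :=
    (continuous_minCoord.comp (PiLp.continuous_ofLp 2 _)).measurable
  have : IsProbabilityMeasure ((gaussianMap A).map fun v : EuclideanSpace ℝ (Fin 4) ↦ minCoord v) :=
    Measure.isProbabilityMeasure_map hm.aemeasurable
  convert continuous_cdf_of_measure_singleton (ν := (gaussianMap A).map fun v : EuclideanSpace ℝ (Fin 4) ↦ minCoord v) ?_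
    using 2 with x
  · rw [cdf_eq_real, measureReal_def, Measure.map_apply hm measurableSet_Iic]
    rfl
  · intro x
    rw [Measure.map_apply hm (measurableSet_singleton x)]
    exact gaussianMap_minCoord_eq_zero hA x

/-- Slutsky's lemma: a perturbation tending to zero in density does not change the limit law. -/
theorem tendsto_cnt_of_negDens {W Z : ℕ → ℕ → ℝ} {F : ℝ → ℝ} (hF : Continuous F)
    (hZ : ∀ x, Tendsto (fun n : ℕ ↦ (cnt (fun m ↦ Z n m ≤ x) n : ℝ) / n) atTop (nhds (F x)))
    (hWZ : ∀ ε : ℝ, 0 < ε → NegDens fun n m ↦ ε ≤ |W n m - Z n m|) (x : ℝ) :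
    Tendsto (fun n : ℕ ↦ (cnt (fun m ↦ W n m ≤ x) n : ℝ) / n) atTop (nhds (F x)) := by
  rw [Metric.tendsto_atTop']
  intro η hη
  obtain ⟨δ, hδ, hFδ⟩ := Metric.continuousAt_iff.mp (hF.continuousAt (x := x)) (η / 4) (by positivity)
  set ε := δ / 2 with hε
  have hε0 : 0 < ε := by positivity
  have a1 : |F (x + ε) - F x| < η / 4 := by
    have := hFδ (x := x + ε) (by rw [Real.dist_eq, add_sub_cancel_left, abs_of_pos hε0]; linarith)
    rwa [Real.dist_eq] at this
  have a2 : |F (x - ε) - F x| < η / 4 := by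
    have := hFδ (x := x - ε) (by
      rw [Real.dist_eq, sub_sub_cancel_left, abs_neg, abs_of_pos hε0]; linarith)
    rwa [Real.dist_eq] at this
  obtain ⟨N, hN⟩ := eventually_atTop.mp <|
    ((Metric.tendsto_nhds.mp (hZ (x + ε)) (η / 4) (by positivity)).and
    (Metric.tendsto_nhds.mp (hZ (x - ε)) (η / 4) (by positivity))).and
    ((hWZ ε hε0).eventually_le (ε := η / 4) (by positivity))
  refine ⟨N, fun n hn ↦ ?_⟩
  obtain ⟨⟨b1, b2⟩, b3⟩ := hN n hn.le
  rw [Real.dist_eq, abs_lt] at b1 b2 ⊢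
  rw [abs_lt] at a1 a2
  have c1 : (cnt (fun m ↦ W n m ≤ x) n : ℝ) / n ≤ (cnt (fun m ↦ Z n m ≤ x + ε) n : ℝ) / n
      + (cnt (fun m ↦ ε ≤ |W n m - Z n m|) n : ℝ) / n := by
    rw [← add_div]
    gcongr
    exact_mod_cast (cnt_mono fun m _ _ h ↦ by
      by_cases hc : ε ≤ |W n m - Z n m|
      · exact Or.inr hc
      · rw [not_le, abs_lt] at hc
        exact Or.inl (by linarith)).trans (cnt_or_le _ _ n)
  have c2 : (cnt (fun m ↦ Z n m ≤ x - ε) n : ℝ) / n ≤ (cnt (fun m ↦ W n m ≤ x) n : ℝ) / n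
      + (cnt (fun m ↦ ε ≤ |W n m - Z n m|) n : ℝ) / n := by
    rw [← add_div]
    gcongr
    exact_mod_cast (cnt_mono fun m _ _ h ↦ by
      by_cases hc : ε ≤ |W n m - Z n m|
      · exact Or.inr hc
      · rw [not_le, abs_lt] at hc
        exact Or.inl (by linarith)).trans (cnt_or_le _ _ n)
  constructor <;> linarith [a1.1, a1.2, a2.1, a2.2, b1.1, b1.2, b2.1, b2.2]

/-- In a finite abelian group, a cyclic subgroup of maximal order is a direct factor. -/
theorem exists_mulEquiv_prod_zmod_exponent (G : Type) [CommGroup G] [Finite G] :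
    ∃ H : Subgroup G, Nonempty (G ≃* H × Multiplicative (ZMod (Monoid.exponent G))) := by
  obtain ⟨g, hg⟩ := Monoid.exists_orderOf_eq_exponent (Monoid.ExponentExists.of_finite (G := G))
  set e := Monoid.exponent G with he
  have he0 : e ≠ 0 := Monoid.exponent_ne_zero_of_finite
  have : NeZero e := ⟨he0⟩
  obtain ⟨ζ', hζ'⟩ := HasEnoughRootsOfUnity.exists_primitiveRoot ℂ e
  obtain ⟨ζ, rfl⟩ := hζ'.isUnit he0
  have hζ : IsPrimitiveRoot ζ e := IsPrimitiveRoot.coe_units_iff.mp hζ'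
  let g' : Subgroup.zpowers g := ⟨g, Subgroup.mem_zpowers g⟩
  have hg' : ∀ x : Subgroup.zpowers g, x ∈ Subgroup.zpowers g' := by
    rintro ⟨x, k, rfl⟩
    exact ⟨k, Subtype.ext (by simp [g'])⟩
  have hord : orderOf ζ ∣ orderOf g' := by
    rw [← hζ.eq_orderOf, ← Subgroup.orderOf_coe, hg]
  obtain ⟨χ, hχ⟩ := MonoidHom.domRestrict_surjective ℂ (Subgroup.zpowers g)
    (monoidHomOfForallMemZpowers hg' hord)
  have hχg : χ g = ζ := by
    have := DFunLike.congr_fun hχ g'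
    rw [monoidHomOfForallMemZpowers_apply_gen] at this
    exact this
  refine ⟨χ.ker, ⟨?_⟩⟩
  let f : χ.ker × Subgroup.zpowers g →* G :=
    χ.ker.subtype.coprod (Subgroup.zpowers g).subtype
  have hf : Function.Bijective f := by
    constructor
    · rw [injective_iff_map_eq_one]
      rintro ⟨⟨a, ha⟩, ⟨b, k, rfl⟩⟩ h
      have h1 : a * g ^ k = 1 := h
      have h2 : ζ ^ k = 1 := by
        have := congrArg χ h1
        rwa [map_mul, MonoidHom.mem_ker.mp ha, one_mul, map_zpow, hχg, map_one] at this
      have h3 : g ^ k = 1 := by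
        rw [← orderOf_dvd_iff_zpow_eq_one, hg]
        exact (hζ.zpow_eq_one_iff_dvd k).mp h2
      have h4 : a = 1 := by rwa [h3, mul_one] at h1
      exact Prod.ext (Subtype.ext h4) (Subtype.ext h3)
    · intro x
      have h1 : χ x ^ e = 1 := by rw [← map_pow, he, Monoid.pow_exponent_eq_one, map_one]
      obtain ⟨k, -, hk'⟩ := hζ'.eq_pow_of_pow_eq_one (ξ := (χ x : ℂ)) (by
        rw [← Units.val_pow_eq_pow_val, h1, Units.val_one])
      have hk : ζ ^ k = χ x := Units.ext (by rw [Units.val_pow_eq_pow_val, hk'])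
      refine ⟨(⟨x * (g ^ k)⁻¹, ?_⟩, ⟨g ^ k, k, by simp⟩), ?_⟩
      · rw [MonoidHom.mem_ker, map_mul, map_inv, map_pow, hχg, hk, mul_inv_cancel]
      · simp [f]
  refine (MulEquiv.ofBijective f hf).symm.trans
    (MulEquiv.prodCongr (MulEquiv.refl _) (mulEquivOfCyclicCardEq ?_))
  rw [Nat.card_zpowers, hg]
  simp

theorem exists_descending_invariant_factors (N : ℕ) : ∀ (G : Type) [CommGroup G] [Finite G],
    Nat.card G ≤ N → ∃ (K : ℕ) (lam : Fin K → ℕ), (∀ j, 1 < lam j) ∧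
      (∀ j k, j ≤ k → lam k ∣ lam j) ∧
      Nonempty (G ≃* Multiplicative (∀ j, ZMod (lam j))) := by
  induction N with
  | zero => intro G _ _ h; exact absurd (Nat.card_pos (α := G)) (by omega)
  | succ N ih =>
    intro G _ _ hN
    have he0 : Monoid.exponent G ≠ 0 := Monoid.exponent_ne_zero_of_finite
    by_cases he : Monoid.exponent G = 1
    · have hs : Subsingleton G := Monoid.exp_eq_one_iff.mp he
      refine ⟨0, Fin.elim0, fun j ↦ j.elim0, fun j ↦ j.elim0, ⟨?_⟩⟩
      have : Unique G := uniqueOfSubsingleton 1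
      exact MulEquiv.ofUnique
    · obtain ⟨H, ⟨f⟩⟩ := exists_mulEquiv_prod_zmod_exponent G
      have hc : Nat.card G = Nat.card H * Monoid.exponent G := by
        rw [Nat.card_congr f.toEquiv, Nat.card_prod]; simp
      have hH : 0 < Nat.card H := Nat.card_pos
      obtain ⟨K, lam, h1, h2, ⟨f'⟩⟩ := ih H (by
        have : 2 ≤ Monoid.exponent G := by omega
        nlinarith)
      have h3 : ∀ j, lam j ∣ Monoid.exponent G := by
        intro j
        have h4 := Monoid.pow_exponent_eq_one
          (f.symm (f'.symm (Multiplicative.ofAdd (Pi.single j 1)), 1))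
        rw [← map_pow, ← map_one f.symm, f.symm.injective.eq_iff, Prod.pow_def, Prod.ext_iff] at h4
        have h5 := h4.1
        simp only [Prod.fst_one] at h5
        rw [← map_pow, ← map_one f'.symm, f'.symm.injective.eq_iff, ← ofAdd_nsmul] at h5
        have h6 := congrFun (Multiplicative.ofAdd.injective h5) j
        rw [Pi.smul_apply, Pi.single_eq_same, nsmul_one] at h6
        exact (ZMod.natCast_eq_zero_iff _ _).mp h6
      refine ⟨K + 1, Fin.cons (Monoid.exponent G) lam, ?_, ?_, ⟨?_⟩⟩
      · refine Fin.cases ?_ fun j ↦ ?_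
        · rw [Fin.cons_zero]; omega
        · rw [Fin.cons_succ]; exact h1 j
      · intro j k hjk
        induction j using Fin.cases with
        | zero =>
          induction k using Fin.cases with
          | zero => exact dvd_rfl
          | succ k => rw [Fin.cons_zero, Fin.cons_succ]; exact h3 k
        | succ j =>
          induction k using Fin.cases with
          | zero => exact absurd hjk (by simp)
          | succ k =>
            rw [Fin.cons_succ, Fin.cons_succ]
            exact h2 j k (Fin.succ_le_succ_iff.mp hjk)
      · refine f.trans ((MulEquiv.prodCongr f' (MulEquiv.refl _)).trans (MulEquiv.prodComm.trans ?_))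
        exact (MulEquiv.prodMultiplicative _ _).symm.trans <| AddEquiv.toMultiplicative
          (Fin.consLinearEquiv ℤ fun j ↦ ZMod (Fin.cons (α := fun _ ↦ ℕ)
            (Monoid.exponent G) lam j)).toAddEquiv

/-- The invariant factor decomposition of a finite abelian group. -/
theorem exists_invariant_factors (G : Type) [CommGroup G] [Finite G] :
    ∃ (K : ℕ) (lam : Fin K → ℕ), (∀ j, 1 < lam j) ∧ (∀ j k, j ≤ k → lam j ∣ lam k) ∧
      Nonempty (G ≃* Multiplicative (∀ j, ZMod (lam j))) := by
  obtain ⟨K, lam, h1, h2, ⟨f⟩⟩ := exists_descending_invariant_factors _ G le_rfl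
  refine ⟨K, fun j ↦ lam j.rev, fun j ↦ h1 _, fun j k h ↦ h2 _ _ (Fin.rev_le_rev.mpr h), ⟨?_⟩⟩
  exact f.trans (AddEquiv.toMultiplicative
    (LinearEquiv.piCongrLeft ℤ (fun j ↦ ZMod (lam j)) Fin.revPerm).symm.toAddEquiv)

/-- The number of solutions of `x ^ k = 1` in `G`. -/
def torsionCard (G : Type*) [CommGroup G] (k : ℕ) : ℕ := Nat.card {x : G // x ^ k = 1}

theorem torsionCard_congr {G H : Type*} [CommGroup G] [CommGroup H] (e : G ≃* H) (k : ℕ) :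
    torsionCard G k = torsionCard H k := by
  refine Nat.card_congr (e.toEquiv.subtypeEquiv fun x ↦ ?_)
  rw [MulEquiv.toEquiv_eq_coe, MulEquiv.coe_toEquiv, ← map_pow, map_eq_one_iff e e.injective]

theorem torsionCard_pi {ι : Type*} [Fintype ι] (G : ι → Type*) [∀ i, CommGroup (G i)] (k : ℕ) :
    torsionCard (∀ i, G i) k = ∏ i, torsionCard (G i) k := by
  unfold torsionCard
  rw [← Nat.card_pi]
  refine Nat.card_congr ((Equiv.subtypeEquivRight fun x ↦ ?_).trans Equiv.subtypePiEquivPi)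
  simp [funext_iff]

theorem torsionCard_of_isCyclic (G : Type*) [CommGroup G] [IsCyclic G] [Finite G] (k : ℕ) :
    torsionCard G k = (Nat.card G).gcd k :=
  IsCyclic.card_powMonoidHom_ker G k

theorem torsionCard_dvd_card (G : Type*) [CommGroup G] (k : ℕ) :
    torsionCard G k ∣ Nat.card G :=
  Subgroup.card_subgroup_dvd_card (powMonoidHom k : G →* G).ker

theorem torsionCard_pos (G : Type*) [CommGroup G] [Finite G] (k : ℕ) : 0 < torsionCard G k := by
  have : Nonempty {x : G // x ^ k = 1} := ⟨⟨1, one_pow k⟩⟩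
  exact Nat.card_pos

theorem gcd_prime_pow_succ {l : ℕ} (hl : l.Prime) (n a : ℕ) :
    n.gcd (l ^ (a + 1)) = n.gcd (l ^ a) * l ^ (if l ^ (a + 1) ∣ n then 1 else 0) := by
  have hd : l ^ a ∣ l ^ (a + 1) := pow_dvd_pow l a.le_succ
  split_ifs with h
  · rw [Nat.gcd_eq_right h, Nat.gcd_eq_right (hd.trans h), pow_one, pow_succ]
  · rw [pow_zero, mul_one]
    refine Nat.dvd_antisymm (Nat.dvd_gcd (Nat.gcd_dvd_left _ _) ?_) (Nat.gcd_dvd_gcd_of_dvd_right n hd)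
    obtain ⟨j, hj, hj'⟩ := (Nat.dvd_prime_pow hl).mp (Nat.gcd_dvd_right n (l ^ (a + 1)))
    rw [hj']
    refine pow_dvd_pow l (Nat.lt_succ_iff.mp (lt_of_le_of_ne hj ?_))
    rintro rfl
    exact h (hj' ▸ Nat.gcd_dvd_left _ _)

theorem torsionCard_prime_pow_succ {G : Type*} [CommGroup G] {ι : Type*} [Fintype ι] {lam : ι → ℕ}
    (h0 : ∀ j, 1 < lam j) (e : G ≃* Multiplicative (∀ j, ZMod (lam j))) {l : ℕ} (hl : l.Prime)
    (a : ℕ) : torsionCard G (l ^ (a + 1))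
      = torsionCard G (l ^ a) * l ^ (Finset.univ.filter fun j ↦ l ^ (a + 1) ∣ lam j).card := by
  have key : ∀ k, torsionCard G k = ∏ j, (lam j).gcd k := by
    intro k
    rw [torsionCard_congr (e.trans (MulEquiv.piMultiplicative fun j ↦ ZMod (lam j))), torsionCard_pi]
    refine Finset.prod_congr rfl fun j _ ↦ ?_
    have : NeZero (lam j) := ⟨by have := h0 j; omega⟩
    rw [torsionCard_of_isCyclic]
    simp
  rw [key, key, Finset.card_filter, ← Finset.prod_pow_eq_pow_sum, ← Finset.prod_mul_distrib]
  exact Finset.prod_congr rfl fun j _ ↦ gcd_prime_pow_succ hl _ _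

theorem exists_torsionCard_prime_pow_succ (G : Type) [CommGroup G] [Finite G] {l : ℕ}
    (hl : l.Prime) (a : ℕ) : ∃ r, torsionCard G (l ^ (a + 1)) = torsionCard G (l ^ a) * l ^ r ∧
      l ^ r ≤ torsionCard G l := by
  obtain ⟨K, lam, h1, -, ⟨e⟩⟩ := exists_invariant_factors G
  refine ⟨_, torsionCard_prime_pow_succ h1 e hl a, ?_⟩
  have h := torsionCard_prime_pow_succ h1 e hl 0
  have h2 : torsionCard G (l ^ 0) = 1 := by
    simp [torsionCard]
  rw [h2, one_mul, zero_add, pow_one] at h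
  rw [h]
  refine Nat.pow_le_pow_right hl.pos (Finset.card_le_card fun j ↦ ?_)
  simp only [Finset.mem_filter, Finset.mem_univ, true_and]
  exact fun h ↦ (dvd_pow_self l a.succ_ne_zero).trans h

theorem mem_of_sq_eq_one_zmod_two_pow {k : ℕ} (x : ZMod (2 ^ (k + 1))) (hx : x ^ 2 = 1) :
    x ∈ ({1, -1, 1 + 2 ^ k, -1 + 2 ^ k} : Finset (ZMod (2 ^ (k + 1)))) := by
  obtain ⟨v, rfl⟩ := ZMod.intCast_surjective x
  have h2 : (2 : ZMod (2 ^ (k + 1))) ^ (k + 1) = 0 := by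
    have := ZMod.natCast_self (2 ^ (k + 1))
    push_cast at this
    exact this
  have hd : (2 : ℤ) ^ (k + 1) ∣ v ^ 2 - 1 := by
    have : ((v ^ 2 - 1 : ℤ) : ZMod (2 ^ (k + 1))) = 0 := by push_cast; rw [hx, sub_self]
    rw [ZMod.intCast_zmod_eq_zero_iff_dvd] at this
    exact_mod_cast this
  have hv : Odd v := by
    have h3 : (2 : ℤ) ∣ v ^ 2 - 1 := (dvd_pow_self 2 k.succ_ne_zero).trans hd
    rcases Int.even_or_odd v with ⟨w, rfl⟩ | h
    · exfalso
      have h4 : (2 : ℤ) ∣ (w + w) ^ 2 := ⟨2 * w ^ 2, by ring⟩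
      omega
    · exact h
  obtain ⟨w, rfl⟩ := hv
  have aux : ∀ u : ℤ, (2 : ZMod (2 ^ (k + 1))) ^ k * u = 0 ∨
      (2 : ZMod (2 ^ (k + 1))) ^ k * u = 2 ^ k := by
    intro u
    rcases Int.even_or_odd u with ⟨t, rfl⟩ | ⟨t, rfl⟩
    · left
      push_cast
      linear_combination (t : ZMod (2 ^ (k + 1))) * h2
    · right
      push_cast
      linear_combination (t : ZMod (2 ^ (k + 1))) * h2
  simp only [Finset.mem_insert, Finset.mem_singleton]
  rcases k with _ | k
  · left
    push_cast
    linear_combination (w : ZMod (2 ^ (0 + 1))) * h2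
  have hd' : (2 : ℤ) ^ k ∣ w * (w + 1) := by
    have h4 : (2 * w + 1) ^ 2 - 1 = 4 * (w * (w + 1)) := by ring
    rw [h4, pow_succ, pow_succ, mul_assoc, mul_comm] at hd
    exact (mul_dvd_mul_iff_left (by norm_num : (4 : ℤ) ≠ 0)).mp (by simpa using hd)
  rcases Int.even_or_odd w with hw | hw
  · have h5 : (2 : ℤ) ^ k ∣ w := by
      refine Int.prime_two.pow_dvd_of_dvd_mul_right k ?_ hd'
      rw [← even_iff_two_dvd, Int.even_add_one]
      exact fun h ↦ h hw
    obtain ⟨u, rfl⟩ := h5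
    rcases aux u with h | h
    · left; push_cast; linear_combination h
    · right; right; left; push_cast; linear_combination h
  · have h5 : (2 : ℤ) ^ k ∣ w + 1 := by
      refine Int.prime_two.pow_dvd_of_dvd_mul_left k ?_ hd'
      rw [← even_iff_two_dvd, Int.not_even_iff_odd]
      exact hw
    obtain ⟨u, hu⟩ := h5
    obtain rfl : w = 2 ^ k * u - 1 := by linarith
    rcases aux u with h | h
    · right; left; push_cast; linear_combination h
    · right; right; right; push_cast; linear_combination h

theorem torsionCard_units_two_pow_le (k : ℕ) :
    torsionCard (ZMod (2 ^ (k + 1)))ˣ 2 ≤ 4 := by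
  let S : Finset (ZMod (2 ^ (k + 1))) := {1, -1, 1 + 2 ^ k, -1 + 2 ^ k}
  let f : {x : (ZMod (2 ^ (k + 1)))ˣ // x ^ 2 = 1} → S := fun x ↦
    ⟨(x.1 : ZMod (2 ^ (k + 1))), mem_of_sq_eq_one_zmod_two_pow _ (by
      rw [← Units.val_pow_eq_pow_val, x.2, Units.val_one])⟩
  have hf : Function.Injective f := fun x y h ↦
    Subtype.ext (Units.ext (congrArg Subtype.val h))
  calc torsionCard (ZMod (2 ^ (k + 1)))ˣ 2 ≤ Nat.card S := Nat.card_le_card_of_injective f hf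
    _ = S.card := by simp
    _ ≤ 4 := Finset.card_le_four

theorem exists_rank_units_two_pow {l : ℕ} (hl : l.Prime) (k a : ℕ) :
    ∃ r, torsionCard (ZMod (2 ^ (k + 1)))ˣ (l ^ (a + 1))
      = torsionCard (ZMod (2 ^ (k + 1)))ˣ (l ^ a) * l ^ r ∧ r ≤ 2 := by
  obtain ⟨r, hr, hr'⟩ := exists_torsionCard_prime_pow_succ (ZMod (2 ^ (k + 1)))ˣ hl a
  refine ⟨r, hr, ?_⟩
  rcases Nat.eq_zero_or_pos r with rfl | hr0
  · exact Nat.zero_le 2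
  have h1 : l ∣ 2 ^ k := by
    have h2 := torsionCard_dvd_card (ZMod (2 ^ (k + 1)))ˣ (l ^ (a + 1))
    rw [hr, Nat.card_eq_fintype_card, ZMod.card_units_eq_totient,
      Nat.totient_prime_pow_succ Nat.prime_two] at h2
    have h3 := ((dvd_pow_self l hr0.ne').trans (Dvd.intro_left _ rfl)).trans h2
    simpa using h3
  obtain rfl : l = 2 := (Nat.prime_dvd_prime_iff_eq hl Nat.prime_two).mp (hl.dvd_of_dvd_pow h1)
  have h4 : 2 ^ r ≤ 2 ^ 2 := hr'.trans (torsionCard_units_two_pow_le k)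
  exact (Nat.pow_le_pow_iff_right (by norm_num)).mp h4

/-- The contribution of a prime power `p ^ (k + 1)` to the number of cyclic factors divisible
by the prime power `l ^ (a + 1)`. -/
theorem exists_rank_units_prime_pow {l p : ℕ} (hl : l.Prime) (hp : p.Prime) (k a : ℕ) :
    ∃ r, torsionCard (ZMod (p ^ (k + 1)))ˣ (l ^ (a + 1))
      = torsionCard (ZMod (p ^ (k + 1)))ˣ (l ^ a) * l ^ r ∧
      (if l ^ (a + 1) ∣ p - 1 then 1 else 0) ≤ r ∧
      r ≤ (if l ^ (a + 1) ∣ p - 1 then 1 else 0) + (if p = 2 then 2 else 0)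
        + (if p = l then 1 else 0) := by
  have hq : 1 < l ^ (a + 1) := Nat.one_lt_pow a.succ_ne_zero hl.one_lt
  by_cases hp2 : p = 2
  · subst hp2
    obtain ⟨r, hr, hr'⟩ := exists_rank_units_two_pow hl k a
    refine ⟨r, hr, ?_, ?_⟩
    · rw [if_neg]
      · exact Nat.zero_le r
      · intro h
        exact absurd (Nat.le_of_dvd (by norm_num) h) (by omega)
    · rw [if_pos rfl (c := (2 : ℕ) = 2)]
      omega
  · have := ZMod.isCyclic_units_of_prime_pow p hp hp2 (k + 1)
    have : NeZero (p ^ (k + 1)) := ⟨pow_ne_zero _ hp.ne_zero⟩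
    refine ⟨if l ^ (a + 1) ∣ Nat.card (ZMod (p ^ (k + 1)))ˣ then 1 else 0, ?_, ?_, ?_⟩
    · rw [torsionCard_of_isCyclic, torsionCard_of_isCyclic]
      exact gcd_prime_pow_succ hl _ _
    all_goals rw [Nat.card_eq_fintype_card, ZMod.card_units_eq_totient,
      Nat.totient_prime_pow_succ hp]
    · by_cases h : l ^ (a + 1) ∣ p - 1
      · rw [if_pos h, if_pos (h.mul_left _)]
      · rw [if_neg h]; exact Nat.zero_le _
    · by_cases hpl : p = l
      · rw [if_pos hpl]
        split_ifs <;> omega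
      · have hc : (l ^ (a + 1)).Coprime (p ^ k) :=
          Nat.Coprime.pow _ _ ((Nat.coprime_primes hl hp).mpr (Ne.symm hpl))
        simp only [hc.dvd_mul_left]
        omega

theorem prime_mod_eq_one_mod_iff {p q : ℕ} (hp : p.Prime) : p % q = 1 % q ↔ q ∣ p - 1 := by
  rw [← Nat.modEq_iff_dvd' hp.one_lt.le]
  exact eq_comm

/-- The number of cyclic factors of `(ℤ/mℤ)ˣ` divisible by a prime power `q` is the number of
primes `p ≡ 1 (mod q)` dividing `m`, up to a bounded error. -/
theorem card_filter_dvd_invariant_factors {m : ℕ} (hm : m ≠ 0) {ι : Type*} [Fintype ι]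
    {lam : ι → ℕ} (h0 : ∀ j, 1 < lam j) (e : (ZMod m)ˣ ≃* Multiplicative (∀ j, ZMod (lam j)))
    {l : ℕ} (hl : l.Prime) (a : ℕ) :
    omegaQ m (l ^ (a + 1)) ≤ (Finset.univ.filter fun j ↦ l ^ (a + 1) ∣ lam j).card ∧
    (Finset.univ.filter fun j ↦ l ^ (a + 1) ∣ lam j).card ≤ omegaQ m (l ^ (a + 1)) + 3 := by
  classical
  set N := (Finset.univ.filter fun j ↦ l ^ (a + 1) ∣ lam j).card with hN
  have hpf : ∀ p : m.primeFactors, ∃ k, m.factorization p = k + 1 := fun p ↦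
    Nat.exists_eq_succ_of_ne_zero (Finsupp.mem_support_iff.mp p.2)
  have hr : ∀ p : m.primeFactors, ∃ r, torsionCard (ZMod ((p : ℕ) ^ (m.factorization p)))ˣ
      (l ^ (a + 1)) = torsionCard (ZMod ((p : ℕ) ^ (m.factorization p)))ˣ (l ^ a) * l ^ r ∧
      (if l ^ (a + 1) ∣ (p : ℕ) - 1 then 1 else 0) ≤ r ∧
      r ≤ (if l ^ (a + 1) ∣ (p : ℕ) - 1 then 1 else 0) + (if (p : ℕ) = 2 then 2 else 0)
        + (if (p : ℕ) = l then 1 else 0) := by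
    intro p
    obtain ⟨k, hk⟩ := hpf p
    rw [hk]
    exact exists_rank_units_prime_pow hl (Nat.prime_of_mem_primeFactors p.2) k a
  choose r hr1 hr2 hr3 using hr
  have hT : ∀ k, torsionCard (ZMod m)ˣ k
      = ∏ p : m.primeFactors, torsionCard (ZMod ((p : ℕ) ^ (m.factorization p)))ˣ k := by
    intro k
    rw [torsionCard_congr ((Units.mapEquiv (ZMod.equivPi m hm).toMulEquiv).trans MulEquiv.piUnits),
      torsionCard_pi]
  have hNr : N = ∑ p, r p := by
    have h1 := torsionCard_prime_pow_succ h0 e hl a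
    rw [← hN, hT, hT, Finset.prod_congr rfl fun p _ ↦ hr1 p, Finset.prod_mul_distrib] at h1
    have hpos : 0 < ∏ p : m.primeFactors,
        torsionCard (ZMod ((p : ℕ) ^ (m.factorization p)))ˣ (l ^ a) := by
      refine Finset.prod_pos fun p _ ↦ ?_
      have : NeZero ((p : ℕ) ^ m.factorization p) :=
        ⟨pow_ne_zero _ (Nat.prime_of_mem_primeFactors p.2).ne_zero⟩
      exact torsionCard_pos _ _
    have h2 := Nat.eq_of_mul_eq_mul_left hpos h1
    rw [Finset.prod_pow_eq_pow_sum] at h2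
    exact (Nat.pow_right_injective hl.two_le h2).symm
  have hω : omegaQ m (l ^ (a + 1))
      = ∑ p : m.primeFactors, if l ^ (a + 1) ∣ (p : ℕ) - 1 then 1 else 0 := by
    rw [omegaQ, Finset.card_filter, ← Finset.sum_coe_sort m.primeFactors]
    refine Finset.sum_congr rfl fun p _ ↦ ?_
    simp only [prime_mod_eq_one_mod_iff (Nat.prime_of_mem_primeFactors p.2)]
  have hsingle : ∀ c b : ℕ, (∑ p : m.primeFactors, if (p : ℕ) = c then b else 0) ≤ b := by
    intro c b
    rw [Finset.sum_coe_sort m.primeFactors fun p ↦ if p = c then b else 0, Finset.sum_ite_eq']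
    split_ifs <;> omega
  rw [hNr, hω]
  refine ⟨Finset.sum_le_sum fun p _ ↦ hr2 p, (Finset.sum_le_sum fun p _ ↦ hr3 p).trans ?_⟩
  rw [Finset.sum_add_distrib, Finset.sum_add_distrib]
  have := hsingle 2 2
  have := hsingle l 1
  omega

section DivisorChain

variable {K : ℕ} {lam : Fin K → ℕ}

theorem filter_dvd_subset_total (hlam : ∀ j k, j ≤ k → lam j ∣ lam k) (a b : ℕ) :
    (Finset.univ.filter fun j ↦ a ∣ lam j) ⊆ (Finset.univ.filter fun j ↦ b ∣ lam j) ∨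
    (Finset.univ.filter fun j ↦ b ∣ lam j) ⊆ (Finset.univ.filter fun j ↦ a ∣ lam j) := by
  by_contra! h
  obtain ⟨h1, h2⟩ := h
  obtain ⟨i, hi, hi'⟩ := Finset.not_subset.mp h1
  obtain ⟨j, hj, hj'⟩ := Finset.not_subset.mp h2
  simp only [Finset.mem_filter, Finset.mem_univ, true_and] at hi hi' hj hj'
  rcases le_total i j with hij | hij
  · exact hj' (hi.trans (hlam i j hij))
  · exact hi' (hj.trans (hlam j i hij))

theorem card_filter_eq_add_card_filter_dvd_le (hlam : ∀ j k, j ≤ k → lam j ∣ lam k) {d q r : ℕ}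
    (hr : r ∣ d) (hq : ¬ q ∣ d)
    (hqr : (Finset.univ.filter fun j ↦ q ∣ lam j).card
      ≤ (Finset.univ.filter fun j ↦ r ∣ lam j).card) :
    (Finset.univ.filter fun j ↦ lam j = d).card + (Finset.univ.filter fun j ↦ q ∣ lam j).card
      ≤ (Finset.univ.filter fun j ↦ r ∣ lam j).card := by
  have hdr : (Finset.univ.filter fun j ↦ lam j = d) ⊆ Finset.univ.filter fun j ↦ r ∣ lam j := by
    intro j hj
    simp only [Finset.mem_filter, Finset.mem_univ, true_and] at hj ⊢
    exact hj ▸ hr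
  have hdq : Disjoint (Finset.univ.filter fun j ↦ lam j = d)
      (Finset.univ.filter fun j ↦ q ∣ lam j) := by
    rw [Finset.disjoint_left]
    intro j hj hj'
    simp only [Finset.mem_filter, Finset.mem_univ, true_and] at hj hj'
    exact hq (hj ▸ hj')
  rcases filter_dvd_subset_total hlam q r with h | h
  · rw [← Finset.card_union_of_disjoint hdq]
    exact Finset.card_le_card (Finset.union_subset hdr h)
  · have h0 : (Finset.univ.filter fun j ↦ lam j = d) = ∅ :=
      Finset.disjoint_self_iff_empty _ |>.mp (hdq.mono_right (hdr.trans h))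
    rw [h0, Finset.card_empty, zero_add]
    exact hqr

theorem eq_twelve_or_exists_dvd {n : ℕ} (h3 : 3 ∣ n) (h4 : 4 ∣ n) :
    n = 12 ∨ ∃ q, (q = 8 ∨ q = 9 ∨ (q.Prime ∧ 5 ≤ q)) ∧ q ∣ n := by
  obtain ⟨t, rfl⟩ : 12 ∣ n := by omega
  by_cases ht : t = 1
  · left; omega
  right
  obtain ⟨p, hp, hpt⟩ := Nat.exists_prime_and_dvd ht
  rcases Nat.lt_or_ge p 5 with h5 | h5
  · have := hp.two_le
    interval_cases p
    · exact ⟨8, by simp, by omega⟩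
    · exact ⟨9, by simp, by omega⟩
    · exact absurd hp (by norm_num)
  · exact ⟨p, Or.inr (Or.inr ⟨hp, h5⟩), hpt.mul_left 12⟩

theorem min_card_filter_dvd_le (hlam : ∀ j k, j ≤ k → lam j ∣ lam k) {B : ℕ}
    (hB : ∀ q, (q = 8 ∨ q = 9 ∨ (q.Prime ∧ 5 ≤ q)) →
      (Finset.univ.filter fun j ↦ q ∣ lam j).card ≤ B) :
    min (Finset.univ.filter fun j ↦ 3 ∣ lam j).card (Finset.univ.filter fun j ↦ 4 ∣ lam j).card
      ≤ (Finset.univ.filter fun j ↦ lam j = 12).card + B := by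
  classical
  set U : Finset (Fin K) := Finset.univ.filter fun j ↦
    ∃ q, (q = 8 ∨ q = 9 ∨ (q.Prime ∧ 5 ≤ q)) ∧ q ∣ lam j with hU
  have hUB : U.card ≤ B := by
    rcases U.eq_empty_or_nonempty with h | h
    · rw [h, Finset.card_empty]; exact Nat.zero_le B
    · obtain ⟨-, q, hq, hq'⟩ := Finset.mem_filter.mp (U.min'_mem h)
      refine (Finset.card_le_card fun j hj ↦ ?_).trans (hB q hq)
      rw [Finset.mem_filter]
      exact ⟨Finset.mem_univ j, hq'.trans (hlam _ _ (U.min'_le j hj))⟩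
  have hS : ∀ j, 3 ∣ lam j → 4 ∣ lam j → j ∈ (Finset.univ.filter fun j ↦ lam j = 12) ∪ U := by
    intro j h3 h4
    rw [Finset.mem_union, Finset.mem_filter, hU, Finset.mem_filter]
    simpa using eq_twelve_or_exists_dvd h3 h4
  have hfin : ((Finset.univ.filter fun j ↦ lam j = 12) ∪ U).card
      ≤ (Finset.univ.filter fun j ↦ lam j = 12).card + B :=
    (Finset.card_union_le _ _).trans (by omega)
  rcases filter_dvd_subset_total hlam 3 4 with h | h
  · refine (min_le_left _ _).trans ((Finset.card_le_card fun j hj ↦ ?_).trans hfin)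
    exact hS j (Finset.mem_filter.mp hj).2 (Finset.mem_filter.mp (h hj)).2
  · refine (min_le_right _ _).trans ((Finset.card_le_card fun j hj ↦ ?_).trans hfin)
    exact hS j (Finset.mem_filter.mp (h hj)).2 (Finset.mem_filter.mp hj).2

end DivisorChain

theorem exists_prime_pow_succ_eq {q : ℕ} (hq : q = 8 ∨ q = 9 ∨ (q.Prime ∧ 5 ≤ q)) :
    ∃ l a, l.Prime ∧ q = l ^ (a + 1) := by
  rcases hq with rfl | rfl | ⟨hq, -⟩
  · exact ⟨2, 2, Nat.prime_two, rfl⟩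
  · exact ⟨3, 1, Nat.prime_three, rfl⟩
  · exact ⟨q, 0, hq, by simp⟩

theorem IsInvCount.add_omegaQ_le {J : ℕ → ℕ} (hJ : IsInvCount 12 J) {m q r : ℕ} (hm : 1 ≤ m)
    (hr : r = 3 ∨ r = 4) (hq : q = 5 ∨ q = 8) (h : omegaQ m q + 3 ≤ omegaQ m r) :
    J m + omegaQ m q ≤ omegaQ m r + 3 := by
  have : NeZero m := ⟨by omega⟩
  obtain ⟨K, lam, h1, h2, ⟨e⟩⟩ := exists_invariant_factors (ZMod m)ˣ
  rw [hJ m hm K lam h1 h2 ⟨e⟩]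
  have hrq := fun (l : ℕ) (hl : l.Prime) a ↦ card_filter_dvd_invariant_factors (by omega) h1 e hl a
  have hq' := hrq 5 Nat.prime_five 0
  have hq'' := hrq 2 Nat.prime_two 2
  have hr' := hrq 3 Nat.prime_three 0
  have hr'' := hrq 2 Nat.prime_two 1
  norm_num at hq' hq'' hr' hr''
  have key := card_filter_eq_add_card_filter_dvd_le h2 (d := 12) (q := q) (r := r)
    (by rcases hr with rfl | rfl <;> norm_num) (by rcases hq with rfl | rfl <;> norm_num)
  rcases hr with rfl | rfl <;> rcases hq with rfl | rfl <;> omega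

theorem IsInvCount.min_omegaQ_le {J : ℕ → ℕ} (hJ : IsInvCount 12 J) {m B : ℕ} (hm : 1 ≤ m)
    (hB : ∀ q, (q = 8 ∨ q = 9 ∨ (q.Prime ∧ 5 ≤ q)) → omegaQ m q ≤ B) :
    min (omegaQ m 3) (omegaQ m 4) ≤ J m + B + 3 := by
  have : NeZero m := ⟨by omega⟩
  obtain ⟨K, lam, h1, h2, ⟨e⟩⟩ := exists_invariant_factors (ZMod m)ˣ
  rw [hJ m hm K lam h1 h2 ⟨e⟩]
  have hrq := fun (l : ℕ) (hl : l.Prime) a ↦ card_filter_dvd_invariant_factors (by omega) h1 e hl a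
  have hr' := hrq 3 Nat.prime_three 0
  have hr'' := hrq 2 Nat.prime_two 1
  norm_num at hr' hr''
  have key := min_card_filter_dvd_le h2 (B := B + 3) fun q hq ↦ by
    obtain ⟨l, a, hl, rfl⟩ := exists_prime_pow_succ_eq hq
    exact (hrq l hl a).2.trans (by have := hB _ hq; omega)
  omega

theorem abs_sub_minCoord_lt {v : Fin 4 → ℝ} {w ε : ℝ} (h1 : ∀ i, w < v i + ε)
    (h2 : ∃ i, v i < w + ε) : |w - minCoord v| < ε := by
  rw [abs_lt]
  constructor
  · obtain ⟨i, hi⟩ := h2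
    have : minCoord v ≤ v i := Finset.inf'_le v (Finset.mem_univ i)
    linarith
  · have : w - ε < minCoord v := by
      rw [minCoord, Finset.lt_inf'_iff]
      intro i _
      linarith [h1 i]
    linarith

/-- The normalized count. -/
def normCount (J : ℕ → ℕ) (n m : ℕ) : ℝ := ((J m : ℝ) - 1 / 4 * LL n) / √(1 / 2 * LL n)

/-- The deterministic comparison between the count and the minimum of the four differences. -/
theorem IsInvCount.abs_normCount_sub_lt {J : ℕ → ℕ} (hJ : IsInvCount 12 J) {n m : ℕ} {ε : ℝ}
    (hn : 3 ≤ n) (hL : 20 ≤ LL n) (hε : 12 < ε * √(1 / 2 * LL n)) (hm : 1 ≤ m) (hmn : m ≤ n)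
    (ht : ∀ q ∈ ({3, 4, 5, 8} : Finset ℕ),
      (omegaQ m q : ℝ) - truncOmega n m q < ε / 2 * √(LL n))
    (hω : ∀ q ∈ ({3, 4, 5, 8, 9} : Finset ℕ),
      |(omegaQ m q : ℝ) - (q.totient : ℝ)⁻¹ * LL n| < 1 / 100 * LL n)
    (hprime : ∀ q : ℕ, q.Prime → 7 ≤ q → (omegaQ m q : ℝ) < 1 / 5 * LL n) :
    |normCount J n m - minCoord (diffVec n m)| < ε := by
  have e3 : Nat.totient 3 = 2 := by decide
  have e4 : Nat.totient 4 = 2 := by decide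
  have e5 : Nat.totient 5 = 4 := by decide
  have e8 : Nat.totient 8 = 4 := by decide
  have e9 : Nat.totient 9 = 6 := by decide
  simp only [Finset.mem_insert, Finset.mem_singleton, forall_eq_or_imp, forall_eq, e3, e4, e5, e8,
    e9, abs_lt] at ht hω
  obtain ⟨t3, t4, t5, t8⟩ := ht
  obtain ⟨⟨l3, u3⟩, ⟨l4, u4⟩, ⟨l5, u5⟩, ⟨l8, u8⟩, ⟨l9, u9⟩⟩ := hω
  norm_num at l3 u3 l4 u4 l5 u5 l8 u8 l9 u9
  have hs0 : 0 < √(1 / 2 * LL n) := Real.sqrt_pos.mpr (by linarith)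
  have hε0 : 0 < ε := by
    by_contra! h
    linarith [mul_nonpos_of_nonpos_of_nonneg h hs0.le]
  have hsL : √(LL n) ≤ 3 / 2 * √(1 / 2 * LL n) := by
    rw [Real.sqrt_le_left (by positivity), mul_pow, Real.sq_sqrt (by linarith)]
    linarith
  have hδ : ε / 2 * √(LL n) + 3 < ε * √(1 / 2 * LL n) := by
    linarith [mul_le_mul_of_nonneg_left hsL (by linarith : 0 ≤ ε / 2)]
  have htr : ∀ q, (truncOmega n m q : ℝ) ≤ omegaQ m q := fun q ↦ by
    exact_mod_cast divCount_truncLevel_le hn (by linarith) hm hmn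
  have hup : ∀ r q, (r = 3 ∨ r = 4) → (q = 5 ∨ q = 8) →
      (J m : ℝ) + omegaQ m q ≤ omegaQ m r + 3 := by
    intro r q hr hq
    have h1 : (omegaQ m q : ℝ) + 3 ≤ omegaQ m r := by
      rcases hr with rfl | rfl <;> rcases hq with rfl | rfl <;> linarith
    exact_mod_cast hJ.add_omegaQ_le hm hr hq (by exact_mod_cast h1)
  have hlow : min (omegaQ m 3) (omegaQ m 4) ≤ J m + max (omegaQ m 5) (omegaQ m 8) + 3 := by
    refine hJ.min_omegaQ_le hm fun q hq ↦ ?_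
    have h5 : ∀ q, (omegaQ m q : ℝ) ≤ omegaQ m 5 → omegaQ m q ≤ max (omegaQ m 5) (omegaQ m 8) :=
      fun q h ↦ le_max_of_le_left (by exact_mod_cast h)
    rcases hq with rfl | rfl | ⟨hq, hq5⟩
    · exact le_max_right _ _
    · exact h5 9 (by linarith)
    · rcases Nat.lt_or_ge q 7 with h7 | h7
      · interval_cases q
        · exact le_max_left _ _
        · exact absurd hq (by norm_num)
      · exact h5 q (by linarith [hprime q hq h7])
  have b3 := htr 3
  have b4 := htr 4
  have b5 := htr 5
  have b8 := htr 8
  have c35 := hup 3 5 (by simp) (by simp)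
  have c38 := hup 3 8 (by simp) (by simp)
  have c45 := hup 4 5 (by simp) (by simp)
  have c48 := hup 4 8 (by simp) (by simp)
  refine abs_sub_minCoord_lt (fun i ↦ ?_) ?_
  · simp only [normCount, diffVec]
    rw [div_add' _ _ _ hs0.ne', div_lt_div_iff_of_pos_right hs0]
    generalize √(1 / 2 * LL n) = s at hδ ⊢
    fin_cases i <;> simp <;> linarith
  · simp only [normCount, diffVec]
    simp_rw [div_add' _ _ _ hs0.ne', div_lt_div_iff_of_pos_right hs0]
    generalize √(1 / 2 * LL n) = s at hδ ⊢
    rcases le_total (omegaQ m 3) (omegaQ m 4) with h | h <;>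
      rcases le_total (omegaQ m 5) (omegaQ m 8) with h' | h' <;>
      simp only [h, h', min_eq_left, min_eq_right, max_eq_left, max_eq_right] at hlow <;>
      have hlow' := (Nat.cast_le (α := ℝ)).mpr hlow <;>
      push_cast at hlow'
    · exact ⟨1, by simp; linarith⟩
    · exact ⟨0, by simp; linarith⟩
    · exact ⟨3, by simp; linarith⟩
    · exact ⟨2, by simp; linarith⟩

theorem IsInvCount.negDens_normCount {J : ℕ → ℕ} (hJ : IsInvCount 12 J) {ε : ℝ} (hε : 0 < ε) :
    NegDens fun n m ↦ ε ≤ |normCount J n m - minCoord (diffVec n m)| := by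
  have h1 : NegDens fun n m ↦ ∃ q ∈ ({3, 4, 5, 8} : Finset ℕ),
      ε / 2 * √(LL n) ≤ (omegaQ m q : ℝ) - truncOmega n m q := by
    refine NegDens.exists_mem _ fun q hq ↦ ?_
    have : NeZero q := ⟨by rintro rfl; simp at hq⟩
    exact negDens_omegaQ_sub_divCount q (by positivity)
  have h2 : NegDens fun n m ↦ ∃ q ∈ ({3, 4, 5, 8, 9} : Finset ℕ),
      1 / 100 * LL n ≤ |(omegaQ m q : ℝ) - (q.totient : ℝ)⁻¹ * LL n| := by
    refine NegDens.exists_mem _ fun q hq ↦ ?_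
    have : NeZero q := ⟨by rintro rfl; simp at hq⟩
    exact negDens_omegaQ q (by positivity)
  refine ((h1.or h2).or negDens_exists_prime_omegaQ).mono ?_
  have hs : Tendsto (fun n : ℕ ↦ ε * √(1 / 2 * LL n)) atTop atTop :=
    (Real.tendsto_sqrt_atTop.comp (tendsto_LL_atTop.const_mul_atTop (by norm_num))).const_mul_atTop hε
  filter_upwards [eventually_ge_atTop 3, tendsto_LL_atTop.eventually_ge_atTop 20,
    hs.eventually_gt_atTop 12] with n hn hL hε' m hm hmn h
  by_contra! hc
  obtain ⟨⟨c1, c2⟩, c3⟩ := hc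
  exact absurd h (not_le.mpr (hJ.abs_normCount_sub_lt hn hL hε' hm hmn c1 c2 c3))

theorem gaussianMap_minCoord_le (A : Matrix (Fin 4) (Fin 4) ℝ) (x : ℝ) :
    gaussianMap A {v | minCoord v ≤ x} = _root_.stdGaussian 4 {z : Fin 4 → ℝ |
      (Finset.univ.inf' Finset.univ_nonempty fun j ↦ A.mulVec z j) ≤ x} := by
  have hc : Continuous fun v : EuclideanSpace ℝ (Fin 4) ↦ minCoord v :=
    continuous_minCoord.comp (PiLp.continuous_ofLp 2 _)
  rw [gaussianMap, Measure.map_apply (measurable_toLp_mulVec A)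
    (isClosed_le hc continuous_const).measurableSet]
  rfl

theorem statement12 (J : ℕ → ℕ) (hJ : IsInvCount 12 J)
    (M : Matrix (Fin 4) (Fin 4) ℝ)
    (hM : M = !![1, 5/8, 1/2, 1/8;
                 5/8, 1, -1/8, 1/4;
                 1/2, -1/8, 1, 3/8;
                 1/8, 1/4, 3/8, 1/2]) :
    ∀ A : Matrix (Fin 4) (Fin 4) ℝ, A * A.transpose = M → ∀ x : ℝ,
      Filter.Tendsto
        (fun n : ℕ => ((cnt (fun m =>
            (J m : ℝ) ≤ (1 / 4) * LL n + x * Real.sqrt ((1 / 2) * LL n)) n : ℝ)) / n)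
        Filter.atTop
        (nhds ((stdGaussian 4 {z : Fin 4 → ℝ |
          (Finset.univ.inf' Finset.univ_nonempty fun j => A.mulVec z j) ≤ x}).toReal)) := by
  intro A hA x
  have hA' : A * A.transpose = covMatrix := hA.trans hM
  have h := tendsto_cnt_of_negDens
    (continuous_gaussianMap_minCoord (by rw [hA']; exact covMatrix_diag_pos))
    (tendsto_cnt_minCoord_diffVec hA') (fun ε hε ↦ hJ.negDens_normCount hε) x
  rw [gaussianMap_minCoord_le] at h
  refine h.congr' ?_
  filter_upwards [tendsto_LL_atTop.eventually_gt_atTop 0] with n hn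
  have hs0 : 0 < √(1 / 2 * LL n) := Real.sqrt_pos.mpr (by linarith)
  simp_rw [normCount, div_le_iff₀ hs0, sub_le_iff_le_add']

end
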